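/- Integration of germs (homogeneity): let 𝖪 be a β-regularising kernel of order (m,r) with range ρ, and let ᾱ ∈ ℝ with m > ᾱ + β. Then for every compact K ⊂ ℝ^d and λ̄ ∈ [1,∞) there is a constant cst'_{K,λ̄} < ∞ such that for every ᾱ-homogeneous germ F of order r, the germ 𝖪F := (𝖪F_x)_x is well-defined and weakly (ᾱ+β)-homogeneous of order r, with weak-homogeneity seminorm on (K,λ̄) at order r bounded by cst'_{K,λ̄} times the ᾱ-homogeneity seminorm of F on (K, 2(λ̄+ρ)) at order r. -/

import Mathlib

open MeasureTheory Metric Filter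
open scoped Classical Pointwise Topology

noncomputable section

/-- Euclidean space `ℝ^d`. -/
abbrev Ed (d : ℕ) := EuclideanSpace ℝ (Fin d)

/-- Multi-indices `k ∈ ℕ₀^d`. -/
abbrev MIdx (d : ℕ) := Fin d → ℕ

variable {d : ℕ}

/-- Degree `|k|` of a multi-index. -/
def mdeg (k : MIdx d) : ℕ := ∑ i, k i

/-- Factorial `k!` of a multi-index. -/
def mfact (k : MIdx d) : ℕ := ∏ i, Nat.factorial (k i)

/-- Monomial `v^k`. -/
def mpow (v : Ed d) (k : MIdx d) : ℝ := ∏ i, (v i) ^ (k i)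

/-- Partial (line) derivative in coordinate `i`. -/
def pd (i : Fin d) (f : Ed d → ℝ) : Ed d → ℝ :=
  fun x => lineDeriv ℝ f x (EuclideanSpace.single i (1:ℝ))

/-- Iterated partial derivative `∂^k`. -/
def mderiv (k : MIdx d) (f : Ed d → ℝ) : Ed d → ℝ :=
  (List.finRange d).foldr (fun i g => (pd i)^[k i] g) f

/-- Smooth compactly supported test function. -/
def IsTest (φ : Ed d → ℝ) : Prop := ContDiff ℝ (⊤ : ℕ∞) φ ∧ HasCompactSupport φ

/-- The `C^r` norm `max_{|k| ≤ r} ‖∂^k φ‖_∞`. -/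
def crNorm (r : ℕ) (φ : Ed d → ℝ) : ℝ :=
  ⨆ k : {k : MIdx d // mdeg k ≤ r}, ⨆ x : Ed d, |mderiv k.1 φ x|

/-- Generalized functions: arbitrary functionals on functions on `ℝ^d`. -/
abbrev DFunc (d : ℕ) := (Ed d → ℝ) → ℝ

/-- `f` is a distribution in `𝒟'(ℝ^d)`: linear on test functions and,
on every compact, bounded by some `C^r` norm. -/
def IsDistribution (f : DFunc d) : Prop :=
  (∀ φ ψ : Ed d → ℝ, IsTest φ → IsTest ψ → f (φ + ψ) = f φ + f ψ) ∧
  (∀ (c : ℝ) (φ : Ed d → ℝ), IsTest φ → f (c • φ) = c * f φ) ∧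
  (∀ K : Set (Ed d), IsCompact K → ∃ (r : ℕ) (C : ℝ),
    ∀ φ : Ed d → ℝ, IsTest φ → tsupport φ ⊆ K → |f φ| ≤ C * crNorm r φ)

/-- `f` is a distribution of order `r` (bound by the `C^r` norm on every compact). -/
def DistOrder (f : DFunc d) (r : ℕ) : Prop :=
  ∀ K : Set (Ed d), IsCompact K → ∃ C : ℝ,
    ∀ φ : Ed d → ℝ, IsTest φ → tsupport φ ⊆ K → |f φ| ≤ C * crNorm r φ

/-- `φ` is of class `C^r`: all iterated coordinate-partials up to order `r`
exist and are continuous. -/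
def IsCr (r : ℕ) (φ : Ed d → ℝ) : Prop :=
  ∀ k : MIdx d, mdeg k ≤ r →
    Continuous (mderiv k φ) ∧
    (mdeg k < r → ∀ (i : Fin d) (x : Ed d),
      LineDifferentiableAt ℝ (mderiv k φ) x (EuclideanSpace.single i (1:ℝ)))

/-- The functional `f` acts canonically (linearly, with local order-`r` bounds) on all
compactly supported `C^r` functions; i.e. `f` incorporates the canonical extension of a
distribution of order `r`. -/
def OrderExt (f : DFunc d) (r : ℕ) : Prop :=
  (∀ φ ψ : Ed d → ℝ, IsCr r φ → HasCompactSupport φ → IsCr r ψ → HasCompactSupport ψ →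
      f (φ + ψ) = f φ + f ψ) ∧
  (∀ (c : ℝ) (φ : Ed d → ℝ), IsCr r φ → HasCompactSupport φ → f (c • φ) = c * f φ) ∧
  (∀ K : Set (Ed d), IsCompact K → ∃ C : ℝ,
    ∀ φ : Ed d → ℝ, IsCr r φ → HasCompactSupport φ → tsupport φ ⊆ K → |f φ| ≤ C * crNorm r φ)

/-- The scaled recentred test function `φ_x^λ(y) = λ^{-d} φ(λ^{-1}(y-x))`. -/
def scTF (φ : Ed d → ℝ) (x : Ed d) (l : ℝ) : Ed d → ℝ :=
  fun y => (l ^ d)⁻¹ * φ (l⁻¹ • (y - x))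

/-- The class `𝓑^r` of smooth test functions supported in the closed unit ball with
all derivatives of order `≤ r` bounded by one. -/
def TB (d r : ℕ) : Set (Ed d → ℝ) :=
  {φ | IsTest φ ∧ tsupport φ ⊆ closedBall (0 : Ed d) 1 ∧
    ∀ k : MIdx d, mdeg k ≤ r → ∀ x, |mderiv k φ x| ≤ 1}

/-- The class `𝓑_γ` of smooth test functions supported in the closed unit ball which
annihilate all monomials of degree `≤ γ`. -/
def TAnn (d : ℕ) (γ : ℝ) : Set (Ed d → ℝ) :=
  {φ | IsTest φ ∧ tsupport φ ⊆ closedBall (0 : Ed d) 1 ∧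
    ∀ k : MIdx d, (mdeg k : ℝ) ≤ γ → (∫ z, φ z * mpow z k) = 0}

/-- The class `𝓑^r_γ = 𝓑^r ∩ 𝓑_γ`. -/
def TBAnn (d r : ℕ) (γ : ℝ) : Set (Ed d → ℝ) := TB d r ∩ TAnn d γ

/-- A germ: a family of functionals indexed by base points. -/
abbrev GermF (d : ℕ) := Ed d → DFunc d

/-- A germ of distributions, measurable in the base point. -/
def IsGerm (F : GermF d) : Prop :=
  (∀ x, IsDistribution (F x)) ∧ ∀ φ : Ed d → ℝ, IsTest φ → Measurable (fun x => F x φ)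

/-- Homogeneity bound with constant `C`: `|F_x(φ_x^λ)| ≤ C λ^ᾱ` on `(K, λ̄)` at order `r`. -/
def HomB (F : GermF d) (a : ℝ) (r : ℕ) (K : Set (Ed d)) (lb C : ℝ) : Prop :=
  ∀ x ∈ K, ∀ l : ℝ, 0 < l → l ≤ lb → ∀ φ ∈ TB d r, |F x (scTF φ x l)| ≤ C * l ^ a

/-- Coherence bound with constant `C`:
`|(F_y - F_x)(φ_x^λ)| ≤ C λ^α (|y-x|+λ)^{γ-α}` on `(K, λ̄)` at order `r`. -/
def CohB (F : GermF d) (a g : ℝ) (r : ℕ) (K : Set (Ed d)) (lb C : ℝ) : Prop :=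
  ∀ x ∈ K, ∀ y ∈ K, ∀ l : ℝ, 0 < l → l ≤ lb → ∀ φ ∈ TB d r,
    |F y (scTF φ x l) - F x (scTF φ x l)| ≤ C * l ^ a * (dist y x + l) ^ (g - a)

/-- `F` is `ᾱ`-homogeneous of order `r`. -/
def Homog (F : GermF d) (a : ℝ) (r : ℕ) : Prop :=
  ∀ K : Set (Ed d), IsCompact K → ∀ lb : ℝ, 1 ≤ lb → ∃ C, HomB F a r K lb C

/-- `F` is `(α, γ)`-coherent of order `r`. -/
def Coh (F : GermF d) (a g : ℝ) (r : ℕ) : Prop :=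
  ∀ K : Set (Ed d), IsCompact K → ∀ lb : ℝ, 1 ≤ lb → ∃ C, CohB F a g r K lb C

/-- Weak homogeneity bound with constant `C` (test functions annihilating polynomials
at small scales, plus a scale-one bound on all of `𝓑^r`). -/
def WHomB (F : GermF d) (a : ℝ) (r : ℕ) (K : Set (Ed d)) (lb C : ℝ) : Prop :=
  (∀ x ∈ K, ∀ l : ℝ, 0 < l → l ≤ lb → ∀ φ ∈ TBAnn d r a,
      |F x (scTF φ x l)| ≤ C * l ^ a) ∧
  (∀ x ∈ K, ∀ ψ ∈ TB d r, |F x (scTF ψ x 1)| ≤ C)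

/-- Weak coherence bound with constant `C`. -/
def WCohB (F : GermF d) (a g : ℝ) (r : ℕ) (K : Set (Ed d)) (lb C : ℝ) : Prop :=
  (∀ x ∈ K, ∀ y ∈ K, ∀ l : ℝ, 0 < l → l ≤ lb → ∀ φ ∈ TBAnn d r g,
      |F y (scTF φ x l) - F x (scTF φ x l)| ≤ C * l ^ a * (dist y x + l) ^ (g - a)) ∧
  (∀ x ∈ K, ∀ y ∈ K, ∀ ψ ∈ TB d r, |F y (scTF ψ x 1) - F x (scTF ψ x 1)| ≤ C)

/-- `F` is weakly `ᾱ`-homogeneous of order `r`. -/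
def WHomog (F : GermF d) (a : ℝ) (r : ℕ) : Prop :=
  ∀ K : Set (Ed d), IsCompact K → ∀ lb : ℝ, 1 ≤ lb → ∃ C, WHomB F a r K lb C

/-- `F` is weakly `(α,γ)`-coherent of order `r`. -/
def WCoh (F : GermF d) (a g : ℝ) (r : ℕ) : Prop :=
  ∀ K : Set (Ed d), IsCompact K → ∀ lb : ℝ, 1 ≤ lb → ∃ C, WCohB F a g r K lb C

/-- The canonical order `r_{ᾱ,α} = min{n ∈ ℕ₀ : n > max(-ᾱ, -α)}`. -/
def rJ (a b : ℝ) : ℕ := (⌊max (-a) (-b)⌋ + 1).toNat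

/-- Joint homogeneity-and-coherence bound at the canonical order. -/
def JointB (F : GermF d) (ab a g : ℝ) (K : Set (Ed d)) (lb C : ℝ) : Prop :=
  HomB F ab (rJ ab a) K lb C ∧ CohB F a g (rJ ab a) K lb C

/-- Joint weak homogeneity-and-coherence bound at the canonical order. -/
def WJointB (F : GermF d) (ab a g : ℝ) (K : Set (Ed d)) (lb C : ℝ) : Prop :=
  WHomB F ab (rJ ab a) K lb C ∧ WCohB F a g (rJ ab a) K lb C

/-- `R` is a `γ`-reconstruction of the `(α,γ)`-coherent germ `F`. -/
def IsRec (F : GermF d) (R : DFunc d) (a g : ℝ) : Prop :=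
  ∀ r : ℕ, -a < (r : ℝ) → ∀ K : Set (Ed d), IsCompact K → ∃ C : ℝ,
    ∀ x ∈ K, ∀ l : ℝ, 0 < l → l ≤ 1 → ∀ φ ∈ TB d r,
      |F x (scTF φ x l) - R (scTF φ x l)| ≤ C * l ^ g

/-- Mixed partial derivative `∂_1^k ∂_2^l K(x,y)` of a kernel. -/
def mixDeriv (k l : MIdx d) (Kf : Ed d → Ed d → ℝ) (x y : Ed d) : ℝ :=
  mderiv k (fun x' => mderiv l (fun y' => Kf x' y') y) x

/-- The kernel `K(x,y)` is of class `C^{m,r}` (mixed partials `∂_1^k ∂_2^l`, `|k| ≤ m`,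
`|l| ≤ r`, exist and are continuous). -/
def IsCmr (m r : ℕ) (Kf : Ed d → Ed d → ℝ) : Prop :=
  ∀ k l : MIdx d, mdeg k ≤ m → mdeg l ≤ r →
    Continuous (fun p : Ed d × Ed d => mixDeriv k l Kf p.1 p.2) ∧
    (mdeg k < m → ∀ (i : Fin d) (x y : Ed d),
      LineDifferentiableAt ℝ (fun x' => mixDeriv k l Kf x' y) x
        (EuclideanSpace.single i (1:ℝ))) ∧
    (mdeg l < r → ∀ (j : Fin d) (x y : Ed d),
      LineDifferentiableAt ℝ (mderiv l (fun y' => Kf x y')) y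
        (EuclideanSpace.single j (1:ℝ)))

/-- `Kn` is the dyadic decomposition of a `β`-regularising kernel of order `(m,r)`
with range `ρ` (Definition 2.3 of the paper). -/
def RegKer (d : ℕ) (β : ℝ) (m r : ℕ) (ρ : ℝ) (Kn : ℕ → Ed d → Ed d → ℝ) : Prop :=
  (∀ n, IsCmr m r (Kn n)) ∧
  (∀ n x y, Kn n x y ≠ 0 → dist x y ≤ ρ * 2 ^ (-(n : ℝ))) ∧
  (∀ K : Set (Ed d), IsCompact K → ∃ c : ℝ, 0 < c ∧
    (∀ n, ∀ k l : MIdx d, mdeg k ≤ m → mdeg l ≤ r → ∀ x ∈ K, ∀ y ∈ K,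
      |mixDeriv k l (Kn n) x y| ≤
        c * 2 ^ ((((d : ℝ) - β + (mdeg l : ℝ) + (mdeg k : ℝ))) * n)) ∧
    (∀ n, ∀ k l : MIdx d, mdeg k ≤ r → mdeg l ≤ r → ∀ y ∈ K,
      |∫ x, mpow (y - x) l * mderiv k (fun y' => Kn n x y') y| ≤ c * 2 ^ (-(β * (n : ℝ)))))

/-- `K_n^* ψ (y) = ∫ ψ(x) K_n(x,y) dx`. -/
def kstar (Kf : Ed d → Ed d → ℝ) (ψ : Ed d → ℝ) : Ed d → ℝ :=
  fun y => ∫ x, ψ x * Kf x y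

/-- `g = 𝖪 f`, i.e. `g(ψ) = Σ_n f(K_n^* ψ)` (with convergence) on test functions. -/
def KInt (Kn : ℕ → Ed d → Ed d → ℝ) (f g : DFunc d) : Prop :=
  ∀ ψ : Ed d → ℝ, IsTest ψ → HasSum (fun n => f (kstar (Kn n) ψ)) (g ψ)

/-- The kernel decomposition preserves polynomials at level `γ`. -/
def PresPoly (Kn : ℕ → Ed d → Ed d → ℝ) (γ : ℝ) : Prop :=
  ∀ n, ∀ k : MIdx d, (mdeg k : ℝ) ≤ γ →
    ∃ p : MvPolynomial (Fin d) ℝ, p.totalDegree ≤ mdeg k ∧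
      ∀ x : Ed d, (∫ y, Kn n x y * mpow y k) = MvPolynomial.eval (fun i => x i) p

/-- Distributional derivative `D^k f (φ) = (-1)^{|k|} f(∂^k φ)`. -/
def distDeriv (k : MIdx d) (f : DFunc d) : DFunc d :=
  fun φ => (-1 : ℝ) ^ (mdeg k) * f (mderiv k φ)

/-- `η ∈ 𝒟` with `∫ η = 1` and vanishing moments of orders `1 ≤ |l| < δ`. -/
def GoodEta (δ : ℝ) (η : Ed d → ℝ) : Prop :=
  IsTest η ∧ (∫ z, η z) = 1 ∧
    ∀ k : MIdx d, 1 ≤ mdeg k → (mdeg k : ℝ) < δ → (∫ z, η z * mpow z k) = 0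

/-- `v` is the pointwise derivative `D^k f(x)`, defined through the limit
`lim_{λ↓0} D^k f(η_x^λ)` for every admissible mollifier `η`. -/
def HasPtDeriv (f : DFunc d) (δ : ℝ) (k : MIdx d) (x : Ed d) (v : ℝ) : Prop :=
  ∀ η : Ed d → ℝ, GoodEta δ η →
    Tendsto (fun l : ℝ => distDeriv k f (scTF η x l)) (nhdsWithin 0 (Set.Ioi 0)) (nhds v)

/-- The Taylor polynomial `Σ_{|k| < δ} c_k (·-x)^k / k!`, viewed as the functional
`ψ ↦ Σ_{|k| < δ} c_k ∫ ψ(y) (y-x)^k / k! dy`. -/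
def taylorF (δ : ℝ) (c : MIdx d → ℝ) (x : Ed d) : DFunc d :=
  fun ψ => ∑ᶠ k ∈ {k : MIdx d | (mdeg k : ℝ) < δ},
    c k * ((∫ y, ψ y * mpow (y - x) k) / (mfact k))

/-- The smallest positive integer `> -γ` (used in Hölder–Zygmund spaces for `γ < 0`). -/
def rNeg (γ : ℝ) : ℕ := (⌊-γ + 1⌋).toNat

/-- The Hölder–Zygmund bound with constant `C` on the compact `K` (with `λ̄ = 1`). -/
def ZBound (γ : ℝ) (f : DFunc d) (K : Set (Ed d)) (C : ℝ) : Prop :=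
  (γ < 0 → ∀ x ∈ K, ∀ l : ℝ, 0 < l → l ≤ 1 → ∀ φ ∈ TB d (rNeg γ),
    |f (scTF φ x l)| ≤ C * l ^ γ) ∧
  (0 ≤ γ →
    (∀ x ∈ K, ∀ ψ ∈ TB d 0, |f (scTF ψ x 1)| ≤ C) ∧
    (∀ x ∈ K, ∀ l : ℝ, 0 < l → l ≤ 1 → ∀ φ ∈ TBAnn d 0 γ,
      |f (scTF φ x l)| ≤ C * l ^ γ))

/-- Membership in the local Hölder–Zygmund space `𝒵^γ`. -/
def MemZ (γ : ℝ) (f : DFunc d) : Prop :=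
  IsDistribution f ∧ ∀ K : Set (Ed d), IsCompact K → ∃ C, ZBound γ f K C

/-- `(Pg, Gg)` is a model with homogeneities `α` of order `rP`, with index set `S`. -/
def IsModelOn {ι : Type} (S : Finset ι) (Pg : ι → GermF d)
    (Gg : ι → ι → Ed d → Ed d → ℝ) (α : ι → ℝ) (rP : ℕ) : Prop :=
  (∀ i ∈ S, IsGerm (Pg i)) ∧
  (∀ i ∈ S, Homog (Pg i) (α i) rP) ∧
  (∀ i ∈ S, ∀ x y : Ed d, ∀ φ : Ed d → ℝ, IsTest φ →
    Pg i y φ = ∑ j ∈ S, Pg j x φ * Gg j i x y)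

/-- The modelled-distribution bound with constant `C` on the compact `K`. -/
def MDB {ι : Type} (S : Finset ι) (Gg : ι → ι → Ed d → Ed d → ℝ) (α : ι → ℝ)
    (γ : ℝ) (f : Ed d → ι → ℝ) (K : Set (Ed d)) (C : ℝ) : Prop :=
  (∀ x ∈ K, ∀ i ∈ S, |f x i| ≤ C) ∧
  (∀ x ∈ K, ∀ y ∈ K, ∀ i ∈ S,
    |(∑ j ∈ S, Gg i j x y * f y j) - f x i| ≤ C * (dist y x) ^ (γ - α i))

/-- `f` is a modelled distribution of order `γ` relative to the model data. -/
def IsMD {ι : Type} (S : Finset ι) (Gg : ι → ι → Ed d → Ed d → ℝ) (α : ι → ℝ)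
    (γ : ℝ) (f : Ed d → ι → ℝ) : Prop :=
  (∀ i ∈ S, Measurable fun x : Ed d => f x i) ∧
  ∀ K : Set (Ed d), IsCompact K → ∃ C, MDB S Gg α γ f K C

/-- The germ `⟨f, Π⟩_x = Σ_i f^i(x) Π^i_x`. -/
def germOf {ι : Type} (S : Finset ι) (Pg : ι → GermF d) (f : Ed d → ι → ℝ) : GermF d :=
  fun x φ => ∑ i ∈ S, f x i * Pg i x φ

/-! ### Multi-index derivatives -/

/-- Unit multi-index. -/
def eI (i : Fin d) : MIdx d := Pi.single i 1

lemma mdeg_zero : mdeg (0 : MIdx d) = 0 := by simp [mdeg]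

lemma mdeg_add (k l : MIdx d) : mdeg (k + l) = mdeg k + mdeg l := by
  simp [mdeg, Finset.sum_add_distrib]

lemma mdeg_eI (i : Fin d) : mdeg (eI i) = 1 := by
  simp [mdeg, eI]

lemma mderiv_list_step (L : List (Fin d)) (hL : L.Nodup) (k : MIdx d) :
    ((∀ i ∈ L, k i = 0) ∧ ∀ f : Ed d → ℝ, L.foldr (fun i g => (pd i)^[k i] g) f = f) ∨
    ∃ i ∈ L, k i ≠ 0 ∧ ∀ f : Ed d → ℝ, L.foldr (fun i g => (pd i)^[k i] g) f =
      pd i (L.foldr (fun j g => (pd j)^[(Function.update k i (k i - 1)) j] g) f) := by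
  induction L with
  | nil => left; simp
  | cons a L ih =>
    have ha : a ∉ L := (List.nodup_cons.1 hL).1
    by_cases h : k a = 0
    · rcases ih (List.nodup_cons.1 hL).2 with ⟨h1, h2⟩ | ⟨i, hi, hk, h2⟩
      · left
        refine ⟨by simpa [h] using h1, fun f => ?_⟩
        simp only [List.foldr_cons, h, Function.iterate_zero, id]
        exact h2 f
      · right
        refine ⟨i, List.mem_cons_of_mem _ hi, hk, fun f => ?_⟩
        have : a ≠ i := fun h => ha (h ▸ hi)
        simp only [List.foldr_cons, h, Function.iterate_zero, id,
          Function.update_of_ne this]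
        exact h2 f
    · right
      refine ⟨a, List.mem_cons_self, h, fun f => ?_⟩
      simp only [List.foldr_cons, Function.update_self]
      rw [← Function.iterate_succ_apply' (pd a)]
      have : (k a - 1).succ = k a := by omega
      rw [this]
      congr 1
      refine List.foldr_ext _ _ _ fun b hb g => ?_
      have : b ≠ a := fun h => ha (h ▸ hb)
      rw [Function.update_of_ne this]

lemma mderiv_zero (f : Ed d → ℝ) : mderiv 0 f = f := by
  rcases mderiv_list_step (List.finRange d) (List.nodup_finRange d) 0 with h | ⟨i, _, h, _⟩
  · exact h.2 f
  · simp at h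

theorem midx_ind {P : MIdx d → Prop} (h0 : P 0)
    (hs : ∀ (i : Fin d) (k : MIdx d), (∀ f : Ed d → ℝ, mderiv (k + eI i) f = pd i (mderiv k f)) →
      P k → P (k + eI i)) (k : MIdx d) : P k := by
  induction hn : mdeg k generalizing k with
  | zero =>
    have : k = 0 := by
      funext i
      simp [mdeg] at hn
      exact hn i
    rwa [this]
  | succ n ih =>
    rcases mderiv_list_step (List.finRange d) (List.nodup_finRange d) k with h | ⟨i, _, hi, h⟩
    · exfalso
      have : mdeg k = 0 := by
        simp only [mdeg]
        exact Finset.sum_eq_zero fun i _ => h.1 i (List.mem_finRange i)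
      omega
    · have e : k = Function.update k i (k i - 1) + eI i := by
        funext j
        by_cases hj : j = i
        · subst hj; simp [eI]; omega
        · simp [eI, hj]
      rw [e]
      apply hs
      · intro f
        rw [← e]
        exact h f
      · apply ih
        have := congrArg mdeg e
        rw [mdeg_add, mdeg_eI] at this
        omega

lemma pd_affine (i : Fin d) (f : Ed d → ℝ) (a c : ℝ) (b : Ed d) :
    pd i (fun y => a * f (c • y + b)) = fun y => a * c * pd i f (c • y + b) := by
  funext y
  simp only [pd, lineDeriv]
  rw [deriv_const_mul_field]
  have := deriv_comp_mul_left c (fun t : ℝ => f (c • y + b + t • EuclideanSpace.single i (1:ℝ))) 0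
  rw [mul_zero, smul_eq_mul] at this
  rw [mul_assoc, ← this]
  congr 2
  funext t
  congr 1
  rw [smul_add, smul_smul]; abel

lemma mderiv_affine (k : MIdx d) (f : Ed d → ℝ) (a c : ℝ) (b : Ed d) :
    mderiv k (fun y => a * f (c • y + b)) = fun y => a * c ^ mdeg k * mderiv k f (c • y + b) := by
  induction k using midx_ind with
  | h0 => simp [mderiv_zero, mdeg_zero]
  | hs i k h ih =>
    rw [h, h, ih, pd_affine, mdeg_add, mdeg_eI]
    funext y; ring

lemma mderiv_translate (k : MIdx d) (f : Ed d → ℝ) (t : Ed d) :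
    mderiv k (fun y => f (y - t)) = fun y => mderiv k f (y - t) := by
  have := mderiv_affine k f 1 1 (-t)
  simpa [← sub_eq_add_neg] using this

lemma mderiv_scTF (k : MIdx d) (φ : Ed d → ℝ) (x : Ed d) (l : ℝ) (y : Ed d) :
    mderiv k (scTF φ x l) y = (l ^ d)⁻¹ * l⁻¹ ^ mdeg k * mderiv k φ (l⁻¹ • (y - x)) := by
  have := congrFun (mderiv_affine k φ (l ^ d)⁻¹ l⁻¹ (-(l⁻¹ • x))) y
  simp only [← sub_eq_add_neg, ← smul_sub] at this
  exact this

lemma pd_tsupport (i : Fin d) (f : Ed d → ℝ) : tsupport (pd i f) ⊆ tsupport f := by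
  refine closure_minimal (fun x hx => ?_) (isClosed_tsupport f)
  by_contra h
  apply hx
  have := (notMem_tsupport_iff_eventuallyEq.1 h).lineDeriv_eq (𝕜 := ℝ)
    (v := EuclideanSpace.single i (1:ℝ))
  simp only [pd]
  rw [this]
  simp [lineDeriv]

lemma mderiv_tsupport (k : MIdx d) (f : Ed d → ℝ) : tsupport (mderiv k f) ⊆ tsupport f := by
  induction k using midx_ind with
  | h0 => simp [mderiv_zero]
  | hs i k h ih => rw [h]; exact (pd_tsupport _ _).trans ih

lemma mderiv_hasCompactSupport (k : MIdx d) {f : Ed d → ℝ} (hf : HasCompactSupport f) :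
    HasCompactSupport (mderiv k f) :=
  hf.of_isClosed_subset (isClosed_tsupport _) (mderiv_tsupport k f)

/-- Strong form of `IsCr`: all coordinate derivatives are the expected ones. -/
def SCr (r : ℕ) (φ : Ed d → ℝ) : Prop :=
  ∀ k : MIdx d, mdeg k ≤ r →
    Continuous (mderiv k φ) ∧
    (mdeg k < r → ∀ (i : Fin d) (x : Ed d),
      HasLineDerivAt ℝ (mderiv k φ) (mderiv (k + eI i) φ x) x (EuclideanSpace.single i (1:ℝ)))

lemma SCr.isCr {r : ℕ} {φ : Ed d → ℝ} (h : SCr r φ) : IsCr r φ :=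
  fun k hk => ⟨(h k hk).1, fun hk' i x => ((h k hk).2 hk' i x).lineDifferentiableAt⟩

lemma pd_contDiff (i : Fin d) {f : Ed d → ℝ} (hf : ContDiff ℝ (⊤ : ℕ∞) f) :
    ContDiff ℝ (⊤ : ℕ∞) (pd i f) := by
  have : pd i f = fun x => fderiv ℝ f x (EuclideanSpace.single i (1:ℝ)) := by
    funext x
    exact (hf.differentiable (by simp) x).lineDeriv_eq_fderiv
  rw [this]
  exact (hf.fderiv_right (m := ((⊤ : ℕ∞) : WithTop ℕ∞)) (by simp)).clm_apply contDiff_const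

lemma mderiv_contDiff (k : MIdx d) {f : Ed d → ℝ} (hf : ContDiff ℝ (⊤ : ℕ∞) f) :
    ContDiff ℝ (⊤ : ℕ∞) (mderiv k f) := by
  induction k using midx_ind with
  | h0 => simpa [mderiv_zero]
  | hs i k h ih => rw [h]; exact pd_contDiff _ ih

lemma pd_comm (i j : Fin d) {f : Ed d → ℝ} (hf : ContDiff ℝ (⊤ : ℕ∞) f) :
    pd i (pd j f) = pd j (pd i f) := by
  have key : ∀ (i : Fin d) {f : Ed d → ℝ}, ContDiff ℝ (⊤ : ℕ∞) f →
      pd i f = fun x => fderiv ℝ f x (EuclideanSpace.single i (1:ℝ)) := by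
    intro i f hf
    funext x
    exact (hf.differentiable (by simp) x).lineDeriv_eq_fderiv
  have hd : Differentiable ℝ (fderiv ℝ f) :=
    (hf.fderiv_right (m := ((⊤ : ℕ∞) : WithTop ℕ∞)) (by simp)).differentiable (by simp)
  have k2 : ∀ i j : Fin d, pd i (pd j f) = fun x => fderiv ℝ (fderiv ℝ f) x
      (EuclideanSpace.single i (1:ℝ)) (EuclideanSpace.single j (1:ℝ)) := by
    intro i j
    rw [key i (pd_contDiff j hf), key j hf]
    funext x
    rw [fderiv_clm_apply (hd x) (by fun_prop)]
    simp
  rw [k2, k2]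
  funext x
  exact (hf.contDiffAt (x := x)).isSymmSndFDerivAt 
    (by rw [minSmoothness_of_isRCLikeNormedField]; exact WithTop.coe_le_coe.2 (le_top : (2 : ℕ∞) ≤ ⊤)) _ _

lemma pd_iter_comm (i j : Fin d) (n : ℕ) {f : Ed d → ℝ} (hf : ContDiff ℝ (⊤ : ℕ∞) f) :
    ContDiff ℝ (⊤ : ℕ∞) ((pd j)^[n] f) ∧ pd i ((pd j)^[n] f) = (pd j)^[n] (pd i f) := by
  induction n with
  | zero => exact ⟨hf, rfl⟩
  | succ n ih =>
    rw [Function.iterate_succ_apply', Function.iterate_succ_apply', ← ih.2]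
    exact ⟨pd_contDiff _ ih.1, pd_comm _ _ ih.1⟩

lemma pd_foldr (L : List (Fin d)) (hL : L.Nodup) (k : MIdx d) (i : Fin d) (hi : i ∈ L)
    {f : Ed d → ℝ} (hf : ContDiff ℝ (⊤ : ℕ∞) f) :
    pd i (L.foldr (fun i g => (pd i)^[k i] g) f) =
      L.foldr (fun j g => (pd j)^[(k + eI i) j] g) f := by
  have hsm : ∀ L : List (Fin d), ContDiff ℝ (⊤ : ℕ∞) (L.foldr (fun i g => (pd i)^[k i] g) f) := by
    intro L
    induction L with
    | nil => exact hf
    | cons a L ih => exact (pd_iter_comm a a _ ih).1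
  induction L with
  | nil => simp at hi
  | cons a L ih =>
    have ha : a ∉ L := (List.nodup_cons.1 hL).1
    simp only [List.foldr_cons]
    by_cases h : a = i
    · subst h
      have e1 : (k + eI a) a = k a + 1 := by simp [eI]
      rw [e1, Function.iterate_succ_apply']
      congr 2
      refine List.foldr_ext _ _ _ fun b hb g => ?_
      have : b ≠ a := fun h => ha (h ▸ hb)
      simp [eI, this]
    · have e1 : (k + eI i) a = k a := by simp [eI, h]
      have hiL : i ∈ L := by
        rcases List.mem_cons.1 hi with h' | h'
        · exact absurd h'.symm h
        · exact h'
      rw [e1, (pd_iter_comm i a _ (hsm L)).2, ih (List.nodup_cons.1 hL).2 hiL]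

lemma pd_mderiv (k : MIdx d) (i : Fin d) {f : Ed d → ℝ} (hf : ContDiff ℝ (⊤ : ℕ∞) f) :
    pd i (mderiv k f) = mderiv (k + eI i) f :=
  pd_foldr _ (List.nodup_finRange d) k i (List.mem_finRange i) hf

lemma SCr_of_contDiff (r : ℕ) {f : Ed d → ℝ} (hf : ContDiff ℝ (⊤ : ℕ∞) f) : SCr r f := by
  intro k _
  refine ⟨(mderiv_contDiff k hf).continuous, fun _ i x => ?_⟩
  rw [← pd_mderiv k i hf]
  exact (((mderiv_contDiff k hf).differentiable (by simp)) x).lineDifferentiableAt.hasLineDerivAt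

lemma mderiv_add {r : ℕ} {f g : Ed d → ℝ} (hf : IsCr r f) (hg : IsCr r g) (k : MIdx d)
    (hk : mdeg k ≤ r) : mderiv k (f + g) = mderiv k f + mderiv k g := by
  induction k using midx_ind with
  | h0 => simp [mderiv_zero]
  | hs i k h ih =>
    rw [mdeg_add, mdeg_eI] at hk
    rw [h, h, h, ih (by omega)]
    funext x
    have h1 := ((hf k (by omega)).2 (by omega) i x).hasLineDerivAt
    have h2 := ((hg k (by omega)).2 (by omega) i x).hasLineDerivAt
    exact (HasLineDerivAt.lineDeriv (HasDerivAt.add h1 h2 :))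

lemma mderiv_smul (c : ℝ) (f : Ed d → ℝ) (k : MIdx d) : mderiv k (c • f) = c • mderiv k f := by
  have := mderiv_affine k f c 1 0
  simp only [one_smul, add_zero, one_pow, mul_one] at this
  exact this

lemma IsCr.add {r : ℕ} {f g : Ed d → ℝ} (hf : IsCr r f) (hg : IsCr r g) : IsCr r (f + g) := by
  intro k hk
  rw [mderiv_add hf hg k hk]
  refine ⟨(hf k hk).1.add (hg k hk).1, fun h i x => ?_⟩
  exact DifferentiableAt.add ((hf k hk).2 h i x) ((hg k hk).2 h i x)

lemma IsCr.smul {r : ℕ} {f : Ed d → ℝ} (hf : IsCr r f) (c : ℝ) : IsCr r (c • f) := by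
  intro k hk
  rw [mderiv_smul]
  refine ⟨(hf k hk).1.const_smul c, fun h i x => ?_⟩
  exact DifferentiableAt.const_smul ((hf k hk).2 h i x) c

/-! ### Parametric integrals and mollification -/

lemma param_continuous {w : Ed d → ℝ} (hw : Continuous w) (hc : HasCompactSupport w)
    {H : Ed d → Ed d → ℝ} (hH : Continuous fun p : Ed d × Ed d => H p.1 p.2) :
    Continuous fun y => ∫ t, w t * H t y := by
  rw [← continuousOn_univ]
  refine continuousOn_integral_of_compact_support (k := tsupport w) hc ?_ ?_
  · refine Continuous.continuousOn ?_
    have : Continuous fun p : Ed d × Ed d => H p.2 p.1 := hH.comp continuous_swap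
    exact (hw.comp continuous_snd).mul this
  · intro y t _ ht
    simp [image_eq_zero_of_notMem_tsupport ht]

lemma param_hasLineDerivAt {w : Ed d → ℝ} (hw : Continuous w) (hc : HasCompactSupport w)
    {H0 H1 : Ed d → Ed d → ℝ} (h0 : Continuous fun p : Ed d × Ed d => H0 p.1 p.2)
    (h1 : Continuous fun p : Ed d × Ed d => H1 p.1 p.2) (v : Ed d)
    (hd : ∀ t y, HasLineDerivAt ℝ (H0 t) (H1 t y) y v) (y : Ed d) :
    HasLineDerivAt ℝ (fun y => ∫ t, w t * H0 t y) (∫ t, w t * H1 t y) y v := by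
  have hcy : ∀ {H : Ed d → Ed d → ℝ}, (Continuous fun p : Ed d × Ed d => H p.1 p.2) → ∀ y,
      Continuous fun t => w t * H t y := fun hH y =>
    hw.mul (hH.comp (continuous_id.prodMk continuous_const))
  obtain ⟨M, hM⟩ := ((hc.prod (isCompact_closedBall (0:ℝ) 1)).image_of_continuousOn
    (f := fun p : Ed d × ℝ => H1 p.1 (y + p.2 • v)) (Continuous.continuousOn
      (h1.comp (continuous_fst.prodMk (continuous_const.add (continuous_snd.smul continuous_const)))))).isBounded.exists_norm_le
  have key := (hasDerivAt_integral_of_dominated_loc_of_deriv_le (μ := (volume : Measure (Ed d)))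
    (F := fun (s : ℝ) t => w t * H0 t (y + s • v)) (F' := fun (s : ℝ) t => w t * H1 t (y + s • v))
    (x₀ := (0:ℝ)) (s := ball 0 1) (bound := fun t => ‖w t‖ * M) (ball_mem_nhds _ one_pos)
    (Eventually.of_forall fun s => (hcy h0 _).aestronglyMeasurable)
    ((hcy h0 _).integrable_of_hasCompactSupport hc.mul_right)
    ((hcy h1 _).aestronglyMeasurable)
    (Eventually.of_forall fun t s hs => ?_)
    ((hw.norm.integrable_of_hasCompactSupport hc.norm).mul_const M)
    (Eventually.of_forall fun t s hs => ?_)).2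
  · simpa [HasLineDerivAt] using key
  · rw [norm_mul]
    by_cases ht : t ∈ tsupport w
    · refine mul_le_mul_of_nonneg_left (hM _ ⟨(t, s), ⟨ht, ball_subset_closedBall hs⟩, rfl⟩)
        (norm_nonneg _)
    · simp [image_eq_zero_of_notMem_tsupport ht]
  · refine HasDerivAt.const_mul _ ?_
    have := hd t (y + s • v)
    unfold HasLineDerivAt at this
    have h2 : HasDerivAt (fun u : ℝ => H0 t (y + s • v + (u - s) • v)) (H1 t (y + s • v)) s := by
      have e : (0:ℝ) = s - s := by ring
      rw [e] at this
      exact this.comp_sub_const s s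
    refine h2.congr_of_eventuallyEq (Eventually.of_forall fun u => ?_)
    simp only
    congr 1
    rw [sub_smul]; abel

lemma param_mderiv {r : ℕ} {w : Ed d → ℝ} (hw : Continuous w) (hc : HasCompactSupport w)
    {H : Ed d → Ed d → ℝ}
    (hH : ∀ k : MIdx d, mdeg k ≤ r → Continuous fun p : Ed d × Ed d => mderiv k (H p.1) p.2)
    (hd : ∀ k : MIdx d, mdeg k < r → ∀ (i : Fin d) t y,
      LineDifferentiableAt ℝ (mderiv k (H t)) y (EuclideanSpace.single i (1:ℝ)))
    (k : MIdx d) (hk : mdeg k ≤ r) :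
    mderiv k (fun y => ∫ t, w t * H t y) = fun y => ∫ t, w t * mderiv k (H t) y := by
  induction k using midx_ind with
  | h0 => simp [mderiv_zero]
  | hs i k h ih =>
    have hk' := hk
    rw [mdeg_add, mdeg_eI] at hk'
    rw [h, ih (by omega)]
    funext y
    refine HasLineDerivAt.lineDeriv (param_hasLineDerivAt hw hc (hH k (by omega)) (hH _ hk) _ ?_ y)
    intro t y
    rw [h]
    exact (hd k (by omega) i t y).hasLineDerivAt

lemma finite_midx (r : ℕ) : {k : MIdx d | mdeg k ≤ r}.Finite := by
  refine (Set.finite_Iic (fun _ : Fin d => r)).subset fun k hk => ?_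
  intro i
  exact (Finset.single_le_sum (f := k) (fun _ _ => Nat.zero_le _) (Finset.mem_univ i)).trans hk

theorem exists_mollify {r : ℕ} {g : Ed d → ℝ} (hg : IsCr r g) (hc : HasCompactSupport g)
    {ε δ : ℝ} (hε : 0 < ε) (hδ : 0 < δ) :
    ∃ h : Ed d → ℝ, IsTest h ∧
      (∀ x R, tsupport g ⊆ closedBall x R → tsupport h ⊆ closedBall x (R + δ)) ∧
      (∀ k : MIdx d, mdeg k ≤ r → ∀ y, |mderiv k h y - mderiv k g y| ≤ ε) ∧
      (∀ k : MIdx d, mdeg k ≤ r → ∀ A, (∀ y, |mderiv k g y| ≤ A) → ∀ y, |mderiv k h y| ≤ A) := by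
  have huc : ∀ᶠ s in 𝓝[>] (0:ℝ), ∀ k ∈ {k : MIdx d | mdeg k ≤ r}, ∀ y z,
      dist y z < s → dist (mderiv k g y) (mderiv k g z) < ε := by
    rw [(finite_midx r).eventually_all]
    intro k hk
    have := (mderiv_hasCompactSupport k hc).uniformContinuous_of_continuous (hg k hk).1
    obtain ⟨s, hs, h⟩ := Metric.uniformContinuous_iff.1 this ε hε
    filter_upwards [Ioo_mem_nhdsGT hs] with s' hs' y z hyz
    exact h (hyz.trans hs'.2)
  obtain ⟨s, hs, hs0, hsδ⟩ := (huc.and (Ioo_mem_nhdsGT hδ)).exists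
  let φ : ContDiffBump (0 : Ed d) := ⟨s / 2, s, by linarith, by linarith⟩
  let η := φ.normed volume
  have hη : Continuous η := φ.continuous_normed
  have hηc : HasCompactSupport η := φ.hasCompactSupport_normed
  have hcg : Continuous g := by simpa [mderiv_zero] using (hg 0 (by simp [mdeg_zero])).1
  have hsm : ContDiff ℝ (⊤ : ℕ∞) (convolution η g (ContinuousLinearMap.lsmul ℝ ℝ) volume) :=
    hηc.contDiff_convolution_left _ φ.contDiff_normed hcg.locallyIntegrable
  have hmd : ∀ k : MIdx d, mdeg k ≤ r →
      mderiv k (convolution η g (ContinuousLinearMap.lsmul ℝ ℝ) volume) =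
      convolution η (mderiv k g) (ContinuousLinearMap.lsmul ℝ ℝ) volume := by
    intro k hk
    have e : ∀ g : Ed d → ℝ, convolution η g (ContinuousLinearMap.lsmul ℝ ℝ) volume =
      fun y => ∫ t, η t * g (y - t) := fun g => rfl
    rw [e, e]
    rw [param_mderiv (r := r) hη hηc (H := fun t y => g (y - t)) ?_ ?_ k hk]
    · simp_rw [mderiv_translate]
    · intro k hk
      simp_rw [mderiv_translate]
      exact (hg k hk).1.comp (continuous_snd.sub continuous_fst)
    · intro k hk i t y
      rw [mderiv_translate]
      have := (hg k hk.le).2 hk i (y - t)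
      unfold LineDifferentiableAt at this ⊢
      convert this using 3
      abel
  refine ⟨convolution η g (ContinuousLinearMap.lsmul ℝ ℝ) volume,
    ⟨hsm, HasCompactSupport.convolution _ hηc hc⟩, ?_, ?_, ?_⟩
  · intro x R hR
    refine closure_minimal ?_ isClosed_closedBall
    intro y hy
    obtain ⟨a, ha, b, hb, rfl⟩ := support_convolution_subset _ hy
    have hb' := hR (subset_tsupport _ hb)
    have ha' : a ∈ ball (0 : Ed d) s := by
      have := φ.support_normed_eq (μ := volume)
      exact this.subset ha
    simp only [mem_closedBall, mem_ball, dist_eq_norm, sub_zero] at *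
    calc ‖a + b - x‖ = ‖a + (b - x)‖ := by congr 1; abel
      _ ≤ ‖a‖ + ‖b - x‖ := norm_add_le _ _
      _ ≤ R + δ := by linarith
  · intro k hk y
    rw [hmd k hk, ← Real.dist_eq]
    refine φ.dist_normed_convolution_le (hg k hk).1.aestronglyMeasurable fun x hx => ?_
    exact (hs k hk x y hx).le
  · intro k hk A hA y
    rw [hmd k hk]
    have hcv : convolution η (mderiv k g) (ContinuousLinearMap.lsmul ℝ ℝ) volume y =
      ∫ t, η t * mderiv k g (y - t) := rfl
    rw [hcv]
    have hi : Integrable η := φ.integrable_normed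
    calc |∫ t, η t * mderiv k g (y - t)| ≤ ∫ t, η t * A := by
          rw [← Real.norm_eq_abs]
          refine norm_integral_le_of_norm_le (hi.mul_const A) (Eventually.of_forall fun t => ?_)
          rw [norm_mul, Real.norm_of_nonneg (φ.nonneg_normed t)]
          exact mul_le_mul_of_nonneg_left (hA _) (φ.nonneg_normed t)
      _ = A := by rw [integral_mul_const, φ.integral_normed, one_mul]

theorem IsCr.sCr {r : ℕ} {g : Ed d → ℝ} (hg : IsCr r g) (hc : HasCompactSupport g) : SCr r g := by
  intro k hk
  refine ⟨(hg k hk).1, fun hk' i x => ?_⟩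
  have := fun n : ℕ => exists_mollify hg hc (Nat.one_div_pos_of_nat (n := n) (α := ℝ)) one_pos
  choose h hT _ hb _ using this
  have hk1 : mdeg (k + eI i) ≤ r := by rw [mdeg_add, mdeg_eI]; omega
  have hu : ∀ k : MIdx d, mdeg k ≤ r →
      TendstoUniformly (fun n => mderiv k (h n)) (mderiv k g) atTop := by
    intro k hk
    rw [Metric.tendstoUniformly_iff]
    intro ε hε
    have := tendsto_one_div_add_atTop_nhds_zero_nat (𝕜 := ℝ)
    filter_upwards [this.eventually (gt_mem_nhds hε)] with n hn y
    rw [dist_comm, Real.dist_eq]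
    exact (hb n k hk y).trans_lt hn
  have := hasDerivAt_of_tendstoUniformly (𝕜 := ℝ) (l := atTop)
    (f := fun n (s : ℝ) => mderiv k (h n) (x + s • EuclideanSpace.single i (1:ℝ)))
    (f' := fun n (s : ℝ) => mderiv (k + eI i) (h n) (x + s • EuclideanSpace.single i (1:ℝ)))
    (g := fun s => mderiv k g (x + s • EuclideanSpace.single i (1:ℝ)))
    (g' := fun s => mderiv (k + eI i) g (x + s • EuclideanSpace.single i (1:ℝ)))
    ((hu _ hk1).comp _) (Eventually.of_forall fun n s => ?_)
    (fun s => (hu k hk).tendsto_at _) 0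
  · simpa [HasLineDerivAt] using this
  · have hd := (SCr_of_contDiff r (hT n).1 k hk).2 hk' i (x + s • EuclideanSpace.single i (1:ℝ))
    unfold HasLineDerivAt at hd
    have e : (0:ℝ) = s - s := by ring
    rw [e] at hd
    refine (hd.comp_sub_const s s).congr_of_eventuallyEq (Eventually.of_forall fun u => ?_)
    simp only
    congr 1
    rw [sub_smul]; abel

/-! ### Taylor expansion -/

lemma taylor_one_dim (N : ℕ) : ∀ (D : ℕ → ℝ → ℝ) (B : ℝ),
    (∀ n t, HasDerivAt (D n) (D (n + 1) t) t) →
    (∀ t ∈ Set.Icc (0:ℝ) 1, |D N t| ≤ B) →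
    ∀ t ∈ Set.Icc (0:ℝ) 1, |D 0 t - ∑ n ∈ Finset.range N, D n 0 * t ^ n / n.factorial| ≤ B := by
  induction N with
  | zero => intro D B _ hB t ht; simpa using hB t ht
  | succ N ih =>
    intro D B hD hB t ht
    have h1 := ih (fun n => D (n + 1)) B (fun n t => hD (n + 1) t) hB
    have hB0 : 0 ≤ B := (abs_nonneg _).trans (hB 0 (by simp))
    have hder : ∀ t, HasDerivAt
        (fun t => D 0 t - ∑ n ∈ Finset.range (N + 1), D n 0 * t ^ n / n.factorial)
        (D 1 t - ∑ n ∈ Finset.range N, D (n + 1) 0 * t ^ n / n.factorial) t := by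
      intro t
      refine (hD 0 t).sub ?_
      have : ∀ n ∈ Finset.range (N + 1), HasDerivAt (fun t : ℝ => D n 0 * t ^ n / n.factorial)
          (D n 0 * (n * t ^ (n - 1)) / n.factorial) t := by
        intro n _
        exact ((hasDerivAt_pow n t).const_mul _).div_const _
      refine (HasDerivAt.fun_sum this).congr_deriv ?_
      rw [Finset.sum_range_succ']
      simp only [Nat.cast_zero, zero_mul, mul_zero, zero_div, add_zero]
      refine Finset.sum_congr rfl fun n _ => ?_
      rw [Nat.factorial_succ]
      push_cast
      have h2 : (n.factorial : ℝ) ≠ 0 := by positivity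
      have h3 : (n : ℝ) + 1 ≠ 0 := by positivity
      field_simp
      try simp
    have := (convex_Icc (0:ℝ) 1).norm_image_sub_le_of_norm_hasDerivWithin_le (C := B)
      (fun t _ => (hder t).hasDerivWithinAt) (fun t ht => h1 t ht)
      (show (0:ℝ) ∈ Set.Icc (0:ℝ) 1 by simp) ht
    have e0 : D 0 0 - ∑ n ∈ Finset.range (N + 1), D n 0 * (0:ℝ) ^ n / n.factorial = 0 := by
      rw [Finset.sum_range_succ']
      simp
    rw [e0, sub_zero, sub_zero, Real.norm_eq_abs, Real.norm_eq_abs, abs_of_nonneg ht.1] at this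
    exact this.trans (by nlinarith [ht.2])

/-- Multi-index counting the entries of a tuple. -/
def cnt {n : ℕ} (I : Fin n → Fin d) : MIdx d := ∑ j, eI (I j)

lemma mdeg_cnt {n : ℕ} (I : Fin n → Fin d) : mdeg (cnt I) = n := by
  induction n with
  | zero => simp [cnt, mdeg_zero]
  | succ n ih =>
    have := ih (fun j => I j.succ)
    unfold cnt at *
    rw [Fin.sum_univ_succ, mdeg_add, mdeg_eI, this]; omega

lemma mpow_add (v : Ed d) (k l : MIdx d) : mpow v (k + l) = mpow v k * mpow v l := by
  simp [mpow, pow_add, Finset.prod_mul_distrib]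

lemma mpow_eI (v : Ed d) (i : Fin d) : mpow v (eI i) = v i := by
  simp only [mpow, eI]
  rw [Finset.prod_eq_single i]
  · simp
  · intro j _ hj; simp [hj]
  · simp

lemma mpow_smul (c : ℝ) (v : Ed d) (k : MIdx d) : mpow (c • v) k = c ^ mdeg k * mpow v k := by
  simp [mpow, mdeg, mul_pow, Finset.prod_mul_distrib, Finset.prod_pow_eq_pow_sum]

lemma abs_mpow_le (v : Ed d) (k : MIdx d) : |mpow v k| ≤ ‖v‖ ^ mdeg k := by
  simp only [mpow, mdeg, Finset.abs_prod, ← Finset.prod_pow_eq_pow_sum]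
  refine Finset.prod_le_prod (fun _ _ => abs_nonneg _) fun i _ => ?_
  rw [abs_pow]
  exact pow_le_pow_left₀ (abs_nonneg _) (PiLp.norm_apply_le v i) _

lemma continuous_mpow (k : MIdx d) : Continuous fun v : Ed d => mpow v k := by
  unfold mpow
  fun_prop

/-- Taylor polynomial of order `< N` at `y`, in direction `v`. -/
def tayl (N : ℕ) (h : Ed d → ℝ) (y v : Ed d) : ℝ :=
  ∑ n ∈ Finset.range N, (∑ I : Fin n → Fin d, mpow v (cnt I) * mderiv (cnt I) h y) / n.factorial

lemma hasDerivAt_line {h : Ed d → ℝ} (hh : ContDiff ℝ (⊤ : ℕ∞) h) (k : MIdx d) (y v : Ed d)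
    (t : ℝ) : HasDerivAt (fun t : ℝ => mderiv k h (y + t • v))
      (∑ i, v i * mderiv (k + eI i) h (y + t • v)) t := by
  have hd := (mderiv_contDiff k hh).differentiable (by simp) (y + t • v)
  have h1 : HasDerivAt (fun t : ℝ => y + t • v) v t := by
    simpa using ((hasDerivAt_id t).smul_const v).const_add y
  have := hd.hasFDerivAt.comp_hasDerivAt t h1
  refine HasDerivAt.congr_deriv this ?_
  symm
  have hv : v = ∑ i, v i • EuclideanSpace.single i (1:ℝ) := by
    ext j
    simp [Pi.single_apply]
  have hv2 := congrArg (fderiv ℝ (mderiv k h) (y + t • v)) hv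
  rw [hv2, map_sum]
  refine Finset.sum_congr rfl fun i _ => ?_
  rw [map_smul, smul_eq_mul, ← pd_mderiv k i hh]
  congr 1
  exact hd.lineDeriv_eq_fderiv

lemma taylor_smooth {h : Ed d → ℝ} (hh : ContDiff ℝ (⊤ : ℕ∞) h) (N : ℕ) (y v : Ed d) (M : ℝ)
    (hM : ∀ k : MIdx d, mdeg k = N → ∀ t ∈ Set.Icc (0:ℝ) 1, |mderiv k h (y + t • v)| ≤ M) :
    |h (y + v) - tayl N h y v| ≤ (d:ℝ) ^ N * (‖v‖ ^ N * M) := by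
  let D : ℕ → ℝ → ℝ := fun n t =>
    ∑ I : Fin n → Fin d, mpow v (cnt I) * mderiv (cnt I) h (y + t • v)
  have hD : ∀ n t, HasDerivAt (D n) (D (n + 1) t) t := by
    intro n t
    have : ∀ I ∈ (Finset.univ : Finset (Fin n → Fin d)),
        HasDerivAt (fun t => mpow v (cnt I) * mderiv (cnt I) h (y + t • v))
        (mpow v (cnt I) * ∑ i, v i * mderiv (cnt I + eI i) h (y + t • v)) t :=
      fun I _ => (hasDerivAt_line hh (cnt I) y v t).const_mul _
    refine (HasDerivAt.fun_sum this).congr_deriv ?_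
    symm
    simp only [D]
    rw [← (Fin.consEquiv (fun _ : Fin (n + 1) => Fin d)).sum_comp, Fintype.sum_prod_type_right]
    refine Finset.sum_congr rfl fun I _ => ?_
    rw [Finset.mul_sum]
    refine Finset.sum_congr rfl fun i _ => ?_
    have : cnt ((Fin.consEquiv (fun _ : Fin (n + 1) => Fin d)) (i, I)) = cnt I + eI i := by
      simp [cnt, Fin.sum_univ_succ, Fin.consEquiv, add_comm]
    rw [this, mpow_add, mpow_eI]; ring
  have key := taylor_one_dim N D ((d:ℝ) ^ N * (‖v‖ ^ N * M)) hD ?_ 1 (by simp)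
  · have e0 : D 0 1 = h (y + v) := by
      simp [D, cnt, mderiv_zero, mpow]
    rw [e0] at key
    simpa [tayl, D] using key
  · intro t ht
    calc |D N t| ≤ ∑ I : Fin N → Fin d, |mpow v (cnt I) * mderiv (cnt I) h (y + t • v)| :=
          Finset.abs_sum_le_sum_abs _ _
      _ ≤ ∑ I : Fin N → Fin d, ‖v‖ ^ N * M := by
          refine Finset.sum_le_sum fun I _ => ?_
          rw [abs_mul]
          have h1 := abs_mpow_le v (cnt I)
          rw [mdeg_cnt] at h1
          exact mul_le_mul h1 (hM _ (mdeg_cnt I) t ht) (abs_nonneg _) (by positivity)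
      _ = _ := by simp

lemma taylor_cr {h : Ed d → ℝ} {N : ℕ} (hh : IsCr N h) (hc : HasCompactSupport h)
    (y v : Ed d) (M : ℝ)
    (hM : ∀ k : MIdx d, mdeg k = N → ∀ t ∈ Set.Icc (0:ℝ) 1, |mderiv k h (y + t • v)| ≤ M) :
    |h (y + v) - tayl N h y v| ≤ (d:ℝ) ^ N * (‖v‖ ^ N * M) := by
  have := fun n : ℕ => exists_mollify hh hc (Nat.one_div_pos_of_nat (n := n) (α := ℝ)) one_pos
  choose g hT _ hb _ using this
  have h0 := tendsto_one_div_add_atTop_nhds_zero_nat (𝕜 := ℝ)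
  have ht : ∀ k : MIdx d, mdeg k ≤ N → ∀ z,
      Tendsto (fun n => mderiv k (g n) z) atTop (𝓝 (mderiv k h z)) := by
    intro k hk z
    rw [tendsto_iff_dist_tendsto_zero]
    exact squeeze_zero (fun _ => dist_nonneg) (fun n => hb n k hk z) h0
  have hz : ∀ z, Tendsto (fun n => g n z) atTop (𝓝 (h z)) := by
    intro z
    simpa [mderiv_zero] using ht 0 (by simp [mdeg_zero]) z
  have h1 : Tendsto (fun n => |g n (y + v) - tayl N (g n) y v|) atTop
      (𝓝 |h (y + v) - tayl N h y v|) := by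
    refine ((hz _).sub ?_).abs
    refine tendsto_finsetSum _ fun n hn => Tendsto.div_const (tendsto_finsetSum _ fun I _ => ?_) _
    refine (ht _ ?_ _).const_mul _
    rw [mdeg_cnt]
    exact (Finset.mem_range.1 hn).le
  have h2 : Tendsto (fun n : ℕ => (d:ℝ) ^ N * (‖v‖ ^ N * (M + 1 / ((n:ℝ) + 1)))) atTop
      (𝓝 ((d:ℝ) ^ N * (‖v‖ ^ N * (M + 0)))) :=
    ((h0.const_add M).const_mul _).const_mul _
  rw [add_zero] at h2
  refine le_of_tendsto_of_tendsto' h1 h2 fun n => ?_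
  refine taylor_smooth (hT n).1 N y v _ fun k hk t ht => ?_
  have a1 := hM k hk t ht
  have a2 := hb n k hk.le (y + t • v)
  have a3 := abs_sub_abs_le_abs_sub (mderiv k (g n) (y + t • v)) (mderiv k h (y + t • v))
  linarith

/-! ### Extending the homogeneity bound to `C^r` functions -/

theorem transfer {r : ℕ} {f : DFunc d} (hO : OrderExt f r) {x : Ed d} {L B : ℝ} (hL : 0 < L)
    (hh : ∀ φ ∈ TB d r, |f (scTF φ x L)| ≤ B) {g : Ed d → ℝ} (hg : IsCr r g)
    (hs : tsupport g ⊆ closedBall x (L / 2)) {A : ℝ} (hA : 0 < A)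
    (hb : ∀ k : MIdx d, mdeg k ≤ r → ∀ y, |mderiv k g y| ≤ A * ((L ^ d)⁻¹ * L⁻¹ ^ mdeg k)) :
    |f g| ≤ A * B := by
  obtain ⟨C0, hC0⟩ := hO.2.2 (closedBall x L) (isCompact_closedBall _ _)
  have hgc : HasCompactSupport g := (isCompact_closedBall x (L / 2)).of_isClosed_subset
    (isClosed_tsupport _) hs
  refine le_of_forall_pos_le_add fun ε hε => ?_
  obtain ⟨h, hT, hsup, happ, hbd⟩ := exists_mollify hg hgc (ε := ε / (|C0| + 1)) (δ := L / 2)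
    (by positivity) (by positivity)
  have hsup' : tsupport h ⊆ closedBall x L := by
    have := hsup x _ hs
    rwa [add_halves] at this
  have hcr : IsCr r h := (SCr_of_contDiff r hT.1).isCr
  have hcr' : IsCr r ((-1 : ℝ) • h) := hcr.smul _
  have hc' : HasCompactSupport ((-1 : ℝ) • h) := HasCompactSupport.smul_left hT.2
  -- difference
  have hdiff : |f (g + (-1 : ℝ) • h)| ≤ ε := by
    have hsd : tsupport (g + (-1 : ℝ) • h) ⊆ closedBall x L := by
      refine closure_minimal (fun y hy => ?_) isClosed_closedBall
      by_contra hy'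
      apply hy
      have h1 : g y = 0 := image_eq_zero_of_notMem_tsupport
        fun h => hy' (closedBall_subset_closedBall (by linarith) (hs h))
      have h2 : h y = 0 := image_eq_zero_of_notMem_tsupport fun h => hy' (hsup' h)
      simp [h1, h2]
    have h1 := hC0 (g + (-1 : ℝ) • h) (hg.add hcr')
      ((isCompact_closedBall x L).of_isClosed_subset (isClosed_tsupport _) hsd) hsd
    have h2 : crNorm r (g + (-1 : ℝ) • h) ≤ ε / (|C0| + 1) := by
      refine Real.iSup_le (fun k => Real.iSup_le (fun y => ?_) (by positivity)) (by positivity)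
      rw [mderiv_add hg hcr' k.1 k.2, mderiv_smul]
      have := happ k.1 k.2 y
      rw [abs_sub_comm] at this
      simpa [← sub_eq_add_neg] using this
    have h3 : 0 ≤ crNorm r (g + (-1 : ℝ) • h) :=
      Real.iSup_nonneg fun k => Real.iSup_nonneg fun y => abs_nonneg _
    calc |f (g + (-1 : ℝ) • h)| ≤ C0 * crNorm r (g + (-1 : ℝ) • h) := h1
      _ ≤ (|C0| + 1) * crNorm r (g + (-1 : ℝ) • h) :=
          mul_le_mul_of_nonneg_right (by linarith [le_abs_self C0]) h3
      _ ≤ (|C0| + 1) * (ε / (|C0| + 1)) := mul_le_mul_of_nonneg_left h2 (by positivity)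
      _ = ε := by field_simp
  -- main part
  have hmain : |f h| ≤ A * B := by
    let φ : Ed d → ℝ := fun z => (A⁻¹ * L ^ d) * h (L • z + x)
    have e1 : h = A • scTF φ x L := by
      funext y
      simp only [scTF, φ, Pi.smul_apply, smul_eq_mul, smul_smul, mul_inv_cancel₀ hL.ne', one_smul,
        sub_add_cancel]
      field_simp
    have hφs : tsupport φ ⊆ closedBall (0 : Ed d) 1 := by
      refine closure_minimal (fun z hz => ?_) isClosed_closedBall
      have : h (L • z + x) ≠ 0 := fun h0 => hz (by simp [φ, h0])
      have := hsup' (subset_tsupport _ this)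
      rw [mem_closedBall, dist_eq_norm, add_sub_cancel_right, norm_smul, Real.norm_of_nonneg hL.le]
        at this
      rw [mem_closedBall_zero_iff]
      exact le_of_mul_le_mul_left (by simpa using this) hL
    have hφT : IsTest φ := by
      refine ⟨?_, (isCompact_closedBall _ _).of_isClosed_subset (isClosed_tsupport _) hφs⟩
      have : ContDiff ℝ (⊤ : ℕ∞) fun z : Ed d => L • z + x := by fun_prop
      exact contDiff_const.mul (hT.1.comp this)
    have hφ : φ ∈ TB d r := by
      refine ⟨hφT, hφs, fun k hk z => ?_⟩
      have e2 : mderiv k φ z = A⁻¹ * L ^ d * L ^ mdeg k * mderiv k h (L • z + x) :=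
        congrFun (mderiv_affine k h (A⁻¹ * L ^ d) L x) z
      have h3 := hbd k hk _ (hb k hk) (L • z + x)
      rw [e2, abs_mul, abs_of_pos (by positivity)]
      calc _ ≤ A⁻¹ * L ^ d * L ^ mdeg k * (A * ((L ^ d)⁻¹ * L⁻¹ ^ mdeg k)) :=
            mul_le_mul_of_nonneg_left h3 (by positivity)
        _ = 1 := by rw [inv_pow]; field_simp
    have hsc : IsTest (scTF φ x L) := by
      have : scTF φ x L = A⁻¹ • h := by
        rw [e1, smul_smul, inv_mul_cancel₀ hA.ne', one_smul]
      rw [this]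
      exact ⟨hT.1.const_smul A⁻¹, HasCompactSupport.smul_left hT.2⟩
    rw [e1, hO.2.1 A _ (SCr_of_contDiff r hsc.1).isCr hsc.2, abs_mul, abs_of_pos hA]
    exact mul_le_mul_of_nonneg_left (hh φ hφ) hA.le
  have hsplit : f g = f h + f (g + (-1 : ℝ) • h) := by
    have hcs : HasCompactSupport (g + (-1 : ℝ) • h) := hgc.add hc'
    rw [← hO.1 h _ hcr hT.2 (hg.add hcr') hcs]
    congr 1
    funext y
    simp
  rw [hsplit]
  exact (abs_add_le _ _).trans (add_le_add hmain hdiff)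

/-! ### Moment estimates -/

/-- Volume of the unit ball. -/
def omegaV (d : ℕ) : ℝ := volume.real (ball (0 : Ed d) 1)

lemma omegaV_nonneg : 0 ≤ omegaV d := measureReal_nonneg

lemma integral_ball_bound {f : Ed d → ℝ} {y : Ed d} {s b : ℝ} (hs : 0 ≤ s)
    (hf : ∀ z, dist z y ≤ s → |f z| ≤ b) (h0 : ∀ z, ¬ dist z y ≤ s → f z = 0) :
    |∫ z, f z| ≤ b * (s ^ d * omegaV d) := by
  have e : ∫ z, f z = ∫ z in closedBall y s, f z := by
    rw [setIntegral_eq_integral_of_forall_compl_eq_zero]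
    intro z hz
    exact h0 z hz
  rw [e, ← Real.norm_eq_abs]
  have h1 := norm_setIntegral_le_of_norm_le_const (μ := (volume : Measure (Ed d))) (f := f)
    (s := closedBall y s) (C := b) measure_closedBall_lt_top (fun z hz => hf z hz)
  rwa [Measure.addHaar_real_closedBall _ _ hs, finrank_euclideanSpace_fin] at h1

lemma integrable_mom {κ : Ed d → ℝ} (hκ : Continuous κ) (hκc : HasCompactSupport κ)
    {f : Ed d → ℝ} (hf : Continuous f) : Integrable fun x => f x * κ x :=
  (hf.mul hκ).integrable_of_hasCompactSupport hκc.mul_left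

lemma continuous_tayl (N : ℕ) (h : Ed d → ℝ) (y : Ed d) :
    Continuous fun v => tayl N h y v := by
  unfold tayl
  refine continuous_finsetSum _ fun n _ => Continuous.div_const
    (continuous_finsetSum _ fun I _ => ?_) _
  exact (continuous_mpow _).mul continuous_const

lemma integral_tayl {κ : Ed d → ℝ} (hκ : Continuous κ) (hκc : HasCompactSupport κ) (N : ℕ)
    (h : Ed d → ℝ) (y : Ed d) :
    ∫ x, tayl N h y (x - y) * κ x = ∑ n ∈ Finset.range N,
      (∑ I : Fin n → Fin d, (∫ x, mpow (x - y) (cnt I) * κ x) * mderiv (cnt I) h y) /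
        n.factorial := by
  have hi : ∀ k : MIdx d, Integrable fun x => mpow (x - y) k * κ x := fun k =>
    integrable_mom hκ hκc ((continuous_mpow k).comp (continuous_id.sub continuous_const))
  have e : (fun x => tayl N h y (x - y) * κ x) = fun x => ∑ n ∈ Finset.range N,
      (∑ I : Fin n → Fin d, (mpow (x - y) (cnt I) * κ x) * mderiv (cnt I) h y) /
        n.factorial := by
    funext x
    simp only [tayl, Finset.sum_mul]
    refine Finset.sum_congr rfl fun n _ => ?_
    rw [div_mul_eq_mul_div, Finset.sum_mul]
    congr 1
    refine Finset.sum_congr rfl fun I _ => ?_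
    ring
  rw [e, integral_finsetSum]
  · refine Finset.sum_congr rfl fun n _ => ?_
    rw [integral_div, integral_finsetSum]
    · simp_rw [integral_mul_const]
    · intro I _
      exact (hi _).mul_const _
  · intro n _
    exact (integrable_finsetSum _ fun I _ => (hi _).mul_const _).div_const _

lemma moment_bound {κ h : Ed d → ℝ} {N : ℕ} {y : Ed d} {s P M T : ℝ} (hs : 0 ≤ s)
    (hP : 0 ≤ P) (hM : 0 ≤ M)
    (hκ : Continuous κ) (hκs : ∀ z, κ z ≠ 0 → dist z y ≤ s) (hκP : ∀ z, |κ z| ≤ P)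
    (hh : IsCr N h) (hc : HasCompactSupport h)
    (hhM : ∀ k : MIdx d, mdeg k = N → ∀ z, dist z y ≤ s → |mderiv k h z| ≤ M)
    (hT : ∀ n < N, ∀ I : Fin n → Fin d,
      |(∫ x, mpow (x - y) (cnt I) * κ x) * mderiv (cnt I) h y| ≤ T) :
    |∫ x, h x * κ x| ≤ (∑ n ∈ Finset.range N, (d:ℝ) ^ n * T) +
      (d:ℝ) ^ N * (s ^ N * M) * P * (s ^ d * omegaV d) := by
  have hκc : HasCompactSupport κ := (isCompact_closedBall y s).of_isClosed_subset
    (isClosed_tsupport _) (closure_minimal (fun z hz => hκs z hz) isClosed_closedBall)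
  have hch : Continuous h := by simpa [mderiv_zero] using (hh 0 (by simp [mdeg_zero])).1
  have hct : Continuous fun x => tayl N h y (x - y) :=
    (continuous_tayl N h y).comp (continuous_id.sub continuous_const)
  have e : ∫ x, h x * κ x =
      (∫ x, tayl N h y (x - y) * κ x) + ∫ x, (h x - tayl N h y (x - y)) * κ x := by
    rw [← integral_add (integrable_mom hκ hκc hct) (integrable_mom hκ hκc
      (f := fun x => h x - tayl N h y (x - y)) (hch.sub hct))]
    refine integral_congr_ae (Eventually.of_forall fun x => ?_)
    simp only
    ring
  rw [e]
  refine (abs_add_le _ _).trans (add_le_add ?_ ?_)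
  · rw [integral_tayl hκ hκc]
    refine (Finset.abs_sum_le_sum_abs _ _).trans (Finset.sum_le_sum fun n hn => ?_)
    rw [abs_div, Nat.abs_cast]
    have h1 : |∑ I : Fin n → Fin d, (∫ x, mpow (x - y) (cnt I) * κ x) * mderiv (cnt I) h y| ≤
        (d:ℝ) ^ n * T := by
      refine (Finset.abs_sum_le_sum_abs _ _).trans
        ((Finset.sum_le_sum fun I _ => hT n (Finset.mem_range.1 hn) I).trans ?_)
      simp
    refine (div_le_self (abs_nonneg _) ?_).trans h1
    exact_mod_cast Nat.one_le_iff_ne_zero.2 (Nat.factorial_ne_zero n)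
  · refine integral_ball_bound (y := y) hs (fun z hz => ?_) fun z hz => ?_
    · rw [abs_mul]
      refine mul_le_mul ?_ (hκP z) (abs_nonneg _) (by positivity)
      have h1 := taylor_cr hh hc y (z - y) M fun k hk t ht => hhM k hk _ ?_
      · rw [add_sub_cancel] at h1
        refine h1.trans ?_
        have : ‖z - y‖ ≤ s := by rwa [← dist_eq_norm]
        gcongr
      · rw [dist_eq_norm, add_sub_cancel_left, norm_smul, Real.norm_of_nonneg ht.1,
          ← dist_eq_norm]
        nlinarith [ht.2, dist_nonneg (x := z) (y := y)]
    · have : κ z = 0 := by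
        by_contra h
        exact hz (hκs z h)
      rw [this, mul_zero]

/-! ### Kernels -/

section kernel

variable {m r : ℕ} {Kf : Ed d → Ed d → ℝ} {s : ℝ}

lemma ker_tsupport (hs : ∀ x y, Kf x y ≠ 0 → dist x y ≤ s) (x : Ed d) :
    tsupport (Kf x) ⊆ closedBall x s :=
  closure_minimal (fun y hy => by rw [mem_closedBall, dist_comm]; exact hs x y hy)
    isClosed_closedBall

lemma ker_mderiv_supp (hs : ∀ x y, Kf x y ≠ 0 → dist x y ≤ s) (l : MIdx d) (x y : Ed d)
    (h : mderiv l (Kf x) y ≠ 0) : dist x y ≤ s := by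
  have := ker_tsupport hs x (mderiv_tsupport l _ (subset_tsupport _ h))
  rwa [mem_closedBall, dist_comm] at this

lemma ker_continuous (hK : IsCmr m r Kf) (l : MIdx d) (hl : mdeg l ≤ r) :
    Continuous fun p : Ed d × Ed d => mderiv l (Kf p.1) p.2 := by
  have := (hK 0 l (by simp [mdeg_zero]) hl).1
  simpa [mixDeriv, mderiv_zero] using this

lemma ker_isCr (hK : IsCmr m r Kf) (x : Ed d) : IsCr r (Kf x) := by
  intro l hl
  refine ⟨(ker_continuous hK l hl).comp (continuous_const.prodMk continuous_id), fun h i y => ?_⟩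
  exact (hK 0 l (by simp [mdeg_zero]) hl).2.2 h i x y

lemma ker_sCr (hK : IsCmr m r Kf) (hs : ∀ x y, Kf x y ≠ 0 → dist x y ≤ s) (x : Ed d) :
    SCr r (Kf x) :=
  (ker_isCr hK x).sCr ((isCompact_closedBall x s).of_isClosed_subset
    (isClosed_tsupport _) (ker_tsupport hs x))

lemma ker_isCr_fst (hK : IsCmr m r Kf) (l : MIdx d) (hl : mdeg l ≤ r) (y : Ed d) :
    IsCr m (fun x => mderiv l (Kf x) y) := by
  intro k hk
  refine ⟨(hK k l hk hl).1.comp (continuous_id.prodMk continuous_const), fun h i x => ?_⟩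
  exact (hK k l hk hl).2.1 h i x y

lemma ker_fst_compact (hs : ∀ x y, Kf x y ≠ 0 → dist x y ≤ s) (l : MIdx d) (y : Ed d) :
    HasCompactSupport (fun x => mderiv l (Kf x) y) :=
  (isCompact_closedBall y s).of_isClosed_subset (isClosed_tsupport _)
    (closure_minimal (fun x hx => ker_mderiv_supp hs l x y hx) isClosed_closedBall)

lemma mderiv_kstar (hK : IsCmr m r Kf) {ψ : Ed d → ℝ} (hψ : IsTest ψ)
    (k : MIdx d) (hk : mdeg k ≤ r) :
    mderiv k (kstar Kf ψ) = fun y => ∫ x, ψ x * mderiv k (Kf x) y :=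
  param_mderiv (r := r) hψ.1.continuous hψ.2 (H := Kf) (fun k hk => ker_continuous hK k hk)
    (fun k hk i t y => (ker_isCr hK t k hk.le).2 hk i y) k hk

lemma isCr_kstar (hK : IsCmr m r Kf) (hs : ∀ x y, Kf x y ≠ 0 → dist x y ≤ s) {ψ : Ed d → ℝ}
    (hψ : IsTest ψ) : IsCr r (kstar Kf ψ) := by
  intro k hk
  rw [mderiv_kstar hK hψ k hk]
  refine ⟨param_continuous hψ.1.continuous hψ.2 (ker_continuous hK k hk), fun h i y => ?_⟩
  have hk1 : mdeg (k + eI i) ≤ r := by rw [mdeg_add, mdeg_eI]; omega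
  exact (param_hasLineDerivAt hψ.1.continuous hψ.2 (ker_continuous hK k hk)
    (ker_continuous hK _ hk1) _ (fun t y => (ker_sCr hK hs t k hk).2 h i y) y).lineDifferentiableAt

lemma kstar_tsupport (hs : ∀ x y, Kf x y ≠ 0 → dist x y ≤ s) {ψ : Ed d → ℝ} {x : Ed d} {R : ℝ}
    (hψ : tsupport ψ ⊆ closedBall x R) : tsupport (kstar Kf ψ) ⊆ closedBall x (R + s) := by
  refine closure_minimal (fun y hy => ?_) isClosed_closedBall
  by_contra hy'
  apply hy
  have : ∀ z, ψ z * Kf z y = 0 := by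
    intro z
    by_contra hz
    have h1 : dist z x ≤ R := hψ (subset_tsupport _ (left_ne_zero_of_mul hz))
    have h2 := hs z y (right_ne_zero_of_mul hz)
    apply hy'
    rw [mem_closedBall]
    have := dist_triangle y z x
    rw [dist_comm y z] at this
    linarith
  simp [kstar, this]

/-- Estimate using the moments of the kernel. -/
lemma kstar_bound_moments (hK : IsCmr m r Kf) (hs0 : 0 ≤ s)
    (hs : ∀ x y, Kf x y ≠ 0 → dist x y ≤ s) {ψ : Ed d → ℝ}
    (hψ : IsTest ψ) (k : MIdx d) (hk : mdeg k ≤ r) {y : Ed d} {P Q M : ℝ}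
    (hP : 0 ≤ P) (hM : 0 ≤ M) 
    (hKP : ∀ x, dist x y ≤ s → |mderiv k (Kf x) y| ≤ P)
    (hKQ : ∀ l : MIdx d, mdeg l ≤ r → |∫ x, mpow (y - x) l * mderiv k (Kf x) y| ≤ Q)
    (hψM : ∀ l : MIdx d, mdeg l ≤ mdeg k → ∀ z, |mderiv l ψ z| ≤ M) :
    |mderiv k (kstar Kf ψ) y| ≤ (∑ n ∈ Finset.range (mdeg k), (d:ℝ) ^ n * (Q * M)) +
      (d:ℝ) ^ mdeg k * (s ^ mdeg k * M) * P * (s ^ d * omegaV d) := by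
  rw [mderiv_kstar hK hψ k hk]
  refine moment_bound (κ := fun x => mderiv k (Kf x) y) hs0 hP hM
    ((ker_continuous hK k hk).comp (continuous_id.prodMk continuous_const))
    (fun z hz => ker_mderiv_supp hs k z y hz) (fun z => ?_)
    (SCr_of_contDiff _ hψ.1).isCr hψ.2 (fun l hl z _ => hψM l hl.le z) fun n hn I => ?_
  · by_cases h : mderiv k (Kf z) y = 0
    · rw [h]; simpa using hP
    · exact hKP z (ker_mderiv_supp hs k z y h)
  · rw [abs_mul]
    have h1 := hKQ (cnt I) (by rw [mdeg_cnt]; omega)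
    refine mul_le_mul ?_ (hψM _ (by rw [mdeg_cnt]; omega) _) (abs_nonneg _)
      ((abs_nonneg _).trans h1)
    have e : (∫ x, mpow (x - y) (cnt I) * mderiv k (Kf x) y) =
        (-1) ^ mdeg (cnt I) * ∫ x, mpow (y - x) (cnt I) * mderiv k (Kf x) y := by
      rw [← integral_const_mul]
      refine integral_congr_ae (Eventually.of_forall fun x => ?_)
      simp only
      rw [← mul_assoc, ← mpow_smul]
      congr 2
      simp
    rw [e, abs_mul, abs_pow]
    simpa using h1

lemma moment_scTF {φ : Ed d → ℝ} {x : Ed d} {l : ℝ} (hl : 0 < l) (k : MIdx d)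
    (h : ∫ z, φ z * mpow z k = 0) : ∫ z, mpow (z - x) k * scTF φ x l z = 0 := by
  have e : (fun z => mpow (z - x) k * scTF φ x l z) = fun z =>
      (l ^ d)⁻¹ * l ^ mdeg k * (fun u => (fun w => φ w * mpow w k) (l⁻¹ • u)) (z - x) := by
    funext z
    have : mpow (z - x) k = l ^ mdeg k * mpow (l⁻¹ • (z - x)) k := by
      rw [mpow_smul, ← mul_assoc, ← mul_pow, mul_inv_cancel₀ hl.ne', one_pow, one_mul]
    rw [this]
    simp only [scTF]
    ring
  rw [e, integral_const_mul, integral_sub_right_eq_self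
    (fun u => (fun w => φ w * mpow w k) (l⁻¹ • u)),
    Measure.integral_comp_smul volume (fun w => φ w * mpow w k) l⁻¹, h]
  simp

lemma scTF_supp {φ : Ed d → ℝ} (hφ : tsupport φ ⊆ closedBall (0 : Ed d) 1) {x : Ed d} {l : ℝ}
    (hl : 0 < l) : tsupport (scTF φ x l) ⊆ closedBall x l := by
  refine closure_minimal (fun z hz => ?_) isClosed_closedBall
  have h1 : φ (l⁻¹ • (z - x)) ≠ 0 := fun h => hz (by simp [scTF, h])
  have := hφ (subset_tsupport _ h1)
  rw [mem_closedBall_zero_iff, norm_smul, norm_inv, Real.norm_of_nonneg hl.le,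
    inv_mul_le_iff₀ hl, mul_one] at this
  rwa [mem_closedBall, dist_eq_norm]

lemma scTF_isTest {φ : Ed d → ℝ} (hT : IsTest φ) (hφ : tsupport φ ⊆ closedBall (0 : Ed d) 1)
    {x : Ed d} {l : ℝ} (hl : 0 < l) : IsTest (scTF φ x l) := by
  refine ⟨?_, (isCompact_closedBall x l).of_isClosed_subset (isClosed_tsupport _)
    (scTF_supp hφ hl)⟩
  have : ContDiff ℝ (⊤ : ℕ∞) fun y : Ed d => l⁻¹ • (y - x) := by fun_prop
  exact contDiff_const.mul (hT.1.comp this)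

/-- Estimate using the vanishing moments of the test function. -/
lemma kstar_bound_ann (hK : IsCmr m r Kf) 
    (hs : ∀ x y, Kf x y ≠ 0 → dist x y ≤ s) {φ : Ed d → ℝ} {γ : ℝ} (hφ : φ ∈ TBAnn d r γ)
    {x : Ed d} {l : ℝ} (hl : 0 < l) (N : ℕ) (hN : N ≤ m) (hNγ : ∀ n : ℕ, n < N → (n : ℝ) ≤ γ)
    (k : MIdx d) (hk : mdeg k ≤ r) {y : Ed d} {M : ℝ} (hM : 0 ≤ M) 
    (hKM : ∀ k' : MIdx d, mdeg k' = N → ∀ z, dist z x ≤ l → |mixDeriv k' k Kf z y| ≤ M) :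
    |mderiv k (kstar Kf (scTF φ x l)) y| ≤ (d:ℝ) ^ N * (l ^ N * M) * omegaV d := by
  have hT := scTF_isTest (x := x) hφ.1.1 hφ.1.2.1 hl
  rw [mderiv_kstar hK hT k hk]
  have hm := moment_bound (κ := scTF φ x l) (h := fun z => mderiv k (Kf z) y) (y := x) (N := N)
    (s := l) (P := (l ^ d)⁻¹) (M := M) (T := 0) hl.le (by positivity) hM hT.1.continuous
    (fun z hz => scTF_supp hφ.1.2.1 hl (subset_tsupport _ hz)) (fun z => ?_)
    (fun k' hk' => ⟨(ker_isCr_fst hK k hk y k' (by omega)).1,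
      fun h => (ker_isCr_fst hK k hk y k' (by omega)).2 (by omega)⟩)
    (ker_fst_compact hs k y) (fun k' hk' z hz => hKM k' hk' z hz) (fun n hn I => ?_)
  · simp only [mul_comm (scTF φ x l _)]
    refine hm.trans (le_of_eq ?_)
    have : l ^ d ≠ 0 := by positivity
    simp
    field_simp
  · have h1 := hφ.1.2.2 0 (by simp [mdeg_zero]) (l⁻¹ • (z - x))
    rw [mderiv_zero] at h1
    simp only [scTF]
    rw [abs_mul, abs_of_pos (by positivity)]
    exact mul_le_of_le_one_right (by positivity) h1
  · rw [moment_scTF hl]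
    · simp
    · refine hφ.2.2.2 _ ?_
      rw [mdeg_cnt]
      exact hNγ n hn

end kernel

/-! ### Single-scale estimates -/

/-- Hypotheses on one dyadic piece of the kernel, at scale `u = 2^{-n}`, on the set `K'`. -/
structure KPiece (d m r : ℕ) (β ρ c u : ℝ) (K' : Set (Ed d)) (Kf : Ed d → Ed d → ℝ) : Prop where
  hu : 0 < u
  hu1 : u ≤ 1
  hc : 0 < c
  hρ : 0 < ρ
  cmr : IsCmr m r Kf
  supp : ∀ x y, Kf x y ≠ 0 → dist x y ≤ ρ * u
  size : ∀ k l : MIdx d, mdeg k ≤ m → mdeg l ≤ r → ∀ x ∈ K', ∀ y ∈ K',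
      |mixDeriv k l Kf x y| ≤ c * (u ^ β * u⁻¹ ^ (d + mdeg l + mdeg k))
  mom : ∀ k l : MIdx d, mdeg k ≤ r → mdeg l ≤ r → ∀ y ∈ K',
      |∫ x, mpow (y - x) l * mderiv k (Kf x) y| ≤ c * u ^ β

/-- Combinatorial constant. -/
def cTwo (d r : ℕ) (ρ : ℝ) : ℝ :=
  ∑ j ∈ Finset.range (r + 1), ((d:ℝ) ^ j + (d:ℝ) ^ j * ρ ^ j * ρ ^ d * omegaV d)

lemma cTwo_pos (d r : ℕ) {ρ : ℝ} (hρ : 0 < ρ) : 0 < cTwo d r ρ := by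
  have h0 := omegaV_nonneg (d := d)
  refine Finset.sum_pos' (fun j _ => by positivity) ⟨0, by simp, ?_⟩
  simp only [pow_zero]
  positivity

section piece

variable {m r : ℕ} {β ρ c u : ℝ} {K' : Set (Ed d)} {Kf : Ed d → Ed d → ℝ}

lemma KPiece.mom_bound (h : KPiece d m r β ρ c u K' Kf) {ψ : Ed d → ℝ} (hψ : IsTest ψ)
    (k : MIdx d) (hk : mdeg k ≤ r) {y : Ed d} {M : ℝ} (hM : 0 ≤ M)
    (hy : closedBall y (ρ * u) ⊆ K')
    (hψM : ∀ l : MIdx d, mdeg l ≤ mdeg k → ∀ z, |mderiv l ψ z| ≤ M) :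
    |mderiv k (kstar Kf ψ) y| ≤ cTwo d r ρ * (c * u ^ β) * M := by
  have hu := h.hu
  have hc := h.hc
  have hρ := h.hρ
  have h0 := omegaV_nonneg (d := d)
  have hyK : y ∈ K' := hy (mem_closedBall_self (by positivity))
  have h1 := kstar_bound_moments h.cmr (by positivity) h.supp hψ k hk (y := y)
    (P := c * (u ^ β * u⁻¹ ^ (d + mdeg k))) (Q := c * u ^ β) (M := M) (by positivity) hM
    (fun x hx => by
      have := h.size 0 k (by simp [mdeg_zero]) hk x (hy hx) y hyK
      simpa [mixDeriv, mderiv_zero, mdeg_zero] using this)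
    (fun l hl => h.mom k l hk hl y hyK) hψM
  refine h1.trans ?_
  have e2 : (d:ℝ) ^ mdeg k * ((ρ * u) ^ mdeg k * M) * (c * (u ^ β * u⁻¹ ^ (d + mdeg k))) *
      ((ρ * u) ^ d * omegaV d) =
      ((d:ℝ) ^ mdeg k * ρ ^ mdeg k * ρ ^ d * omegaV d) * (c * u ^ β * M) := by
    have : u ^ mdeg k * u ^ d * u⁻¹ ^ (d + mdeg k) = 1 := by
      rw [← pow_add, add_comm (mdeg k), ← mul_pow, mul_inv_cancel₀ hu.ne', one_pow]
    rw [mul_pow, mul_pow]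
    linear_combination ((d:ℝ) ^ mdeg k * ρ ^ mdeg k * ρ ^ d * omegaV d * c * u ^ β * M) * this
  rw [e2, ← Finset.sum_mul, show c * u ^ β * M = (c * u ^ β) * M from rfl, ← add_mul,
    show cTwo d r ρ * (c * u ^ β) * M = cTwo d r ρ * (c * u ^ β * M) by ring]
  refine mul_le_mul_of_nonneg_right ?_ (by positivity)
  rw [cTwo, Finset.sum_add_distrib]
  refine add_le_add (Finset.sum_le_sum_of_subset_of_nonneg ?_ fun j _ _ => by positivity) ?_
  · exact Finset.range_mono (by omega)
  · exact Finset.single_le_sum (f := fun j => (d:ℝ) ^ j * ρ ^ j * ρ ^ d * omegaV d)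
      (fun j _ => by positivity) (Finset.mem_range.2 (by omega))

lemma rpow_two_sided {p q t L a : ℝ} (hp : 0 < p) (ht : 0 < t) (h1 : p * t ≤ L) (h2 : L ≤ q * t) :
    L ^ a ≤ (p ^ a + q ^ a) * t ^ a := by
  have hL : 0 < L := (mul_pos hp ht).trans_le h1
  have hq : 0 < q := by
    by_contra hq
    nlinarith
  have hpa := Real.rpow_pos_of_pos hp a
  have hqa := Real.rpow_pos_of_pos hq a
  have hta := Real.rpow_pos_of_pos ht a
  rcases le_total 0 a with ha | ha
  · have := Real.rpow_le_rpow hL.le h2 ha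
    rw [Real.mul_rpow hq.le ht.le] at this
    nlinarith [mul_pos hpa hta]
  · have := Real.rpow_le_rpow_of_nonpos (mul_pos hp ht) h1 ha
    rw [Real.mul_rpow hp.le ht.le] at this
    nlinarith [mul_pos hqa hta]

lemma inv_pow_scale {t L q : ℝ} (ht : 0 < t) (hL : 0 < L) (h2 : L ≤ q * t) (hq : 1 ≤ q)
    {j : ℕ} (hj : j ≤ r) : t⁻¹ ^ (d + j) ≤ q ^ (d + r) * ((L ^ d)⁻¹ * L⁻¹ ^ j) := by
  have h3 : t⁻¹ ≤ q * L⁻¹ := by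
    rw [← div_eq_mul_inv, le_div_iff₀ hL, inv_mul_le_iff₀ ht]
    linarith
  calc t⁻¹ ^ (d + j) ≤ (q * L⁻¹) ^ (d + j) := by gcongr
    _ = q ^ (d + j) * ((L ^ d)⁻¹ * L⁻¹ ^ j) := by rw [mul_pow, pow_add L⁻¹, inv_pow]
    _ ≤ _ := by
      gcongr

/-- Constant for the small-scale regime. -/
def cB (d r : ℕ) (ρ c lb a : ℝ) : ℝ :=
  cTwo d r ρ * c * lb ^ r * (2 * (1 + ρ)) ^ (d + r) * (2 ^ a + (2 * (1 + ρ)) ^ a)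

/-- Constant for the large-scale regime. -/
def cA (d r N : ℕ) (ρ c a : ℝ) : ℝ :=
  ((d:ℝ) ^ N * omegaV d + 1) * c * (2 * (1 + ρ)) ^ (d + r) *
    ((2 * ρ) ^ a + (2 * (1 + ρ)) ^ a)

lemma cB_nonneg {lb a : ℝ} (hρ : 0 < ρ) (hc : 0 < c) (hlb : 1 ≤ lb) : 0 ≤ cB d r ρ c lb a := by
  have := cTwo_pos d r hρ
  unfold cB
  positivity

lemma cA_nonneg {N : ℕ} {a : ℝ} (hρ : 0 < ρ) (hc : 0 < c) : 0 ≤ cA d r N ρ c a := by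
  have := omegaV_nonneg (d := d)
  unfold cA
  positivity

/-- Regime `2^{-n} ≤ λ`. -/
lemma KPiece.small (h : KPiece d m r β ρ c u K' Kf) {f : DFunc d} (hO : OrderExt f r)
    {lb a C l : ℝ} {x : Ed d} (hlb : 1 ≤ lb) (hC : 0 ≤ C) (hl : 0 < l) (hllb : l ≤ lb)
    (hul : u ≤ l) (hxK : closedBall x (lb + 2 * ρ) ⊆ K')
    (hF : ∀ L : ℝ, 0 < L → L ≤ 2 * (lb + ρ) → ∀ φ ∈ TB d r, |f (scTF φ x L)| ≤ C * L ^ a)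
    {φ : Ed d → ℝ} (hφ : φ ∈ TB d r) :
    |f (kstar Kf (scTF φ x l))| ≤ cB d r ρ c lb a * C * (u ^ β * l ^ a) := by
  have hu := h.hu
  have hu1 := h.hu1
  have hc := h.hc
  have hρ := h.hρ
  have hρu : ρ * u ≤ ρ := by nlinarith
  have hρu' : ρ * u ≤ ρ * l := by nlinarith
  have hρu0 : 0 < ρ * u := by positivity
  have hct := cTwo_pos d r hρ
  set L := 2 * (l + ρ * u) with hLdef
  have hL : 0 < L := by positivity
  have hT := scTF_isTest (x := x) hφ.1 hφ.2.1 hl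
  have hsupp := kstar_tsupport h.supp (scTF_supp hφ.2.1 hl (x := x))
  have hLq : L ≤ (2 * (1 + ρ)) * l := by rw [hLdef]; linarith
  have hq1 : 1 ≤ 2 * (1 + ρ) := by linarith
  have key := transfer (x := x) (L := L) (B := C * L ^ a)
    (A := cTwo d r ρ * (c * u ^ β) * (lb ^ r * (2 * (1 + ρ)) ^ (d + r))) hO hL
    (hF L hL (by rw [hLdef]; linarith)) (isCr_kstar h.cmr h.supp hT)
    (hsupp.trans (closedBall_subset_closedBall (by rw [hLdef]; linarith))) (by positivity)
    (fun k hk y => by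
      by_cases hy : dist y x ≤ l + ρ * u
      · have hb := h.mom_bound hT k hk (y := y) (M := lb ^ r * l⁻¹ ^ (d + mdeg k)) (by positivity)
          ((closedBall_subset_closedBall' (by linarith)).trans hxK) (fun j hj z => by
            rw [mderiv_scTF, abs_mul, abs_of_nonneg (by positivity)]
            have h1 := hφ.2.2 j (hj.trans hk) (l⁻¹ • (z - x))
            have h2 : (l ^ d)⁻¹ * l⁻¹ ^ mdeg j ≤ lb ^ r * l⁻¹ ^ (d + mdeg k) := by
              have e : l⁻¹ ^ mdeg j = l ^ (mdeg k - mdeg j) * l⁻¹ ^ mdeg k := by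
                conv_rhs => rw [← Nat.sub_add_cancel hj, pow_add, ← mul_assoc]
                rw [Nat.sub_add_cancel hj, ← mul_pow, mul_inv_cancel₀ hl.ne', one_pow, one_mul]
              have h3 : l ^ (mdeg k - mdeg j) ≤ lb ^ r :=
                (pow_le_pow_left₀ hl.le hllb _).trans (pow_le_pow_right₀ hlb (by omega))
              rw [e, pow_add, ← inv_pow]
              calc _ = l ^ (mdeg k - mdeg j) * (l⁻¹ ^ d * l⁻¹ ^ mdeg k) := by ring
                _ ≤ _ := by gcongr
            refine (mul_le_of_le_one_right (by positivity) h1).trans h2)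
        refine hb.trans ?_
        rw [mul_assoc (cTwo d r ρ * (c * u ^ β)), mul_assoc (lb ^ r)]
        gcongr
        exact inv_pow_scale hl hL hLq hq1 hk
      · have : mderiv k (kstar Kf (scTF φ x l)) y = 0 := by
          by_contra hne
          exact hy (hsupp (mderiv_tsupport k _ (subset_tsupport _ hne)))
        rw [this, abs_zero]
        positivity)
  refine key.trans ?_
  have hLa := rpow_two_sided (p := 2) (q := 2 * (1 + ρ)) (t := l) (L := L) (a := a) two_pos hl
    (by rw [hLdef]; linarith) hLq
  calc _ ≤ cTwo d r ρ * (c * u ^ β) * (lb ^ r * (2 * (1 + ρ)) ^ (d + r)) *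
        (C * ((2 ^ a + (2 * (1 + ρ)) ^ a) * l ^ a)) := by gcongr
    _ = _ := by rw [cB]; ring

/-- Regime `λ ≤ 2^{-n}`. -/
lemma KPiece.large (h : KPiece d m r β ρ c u K' Kf) {f : DFunc d} (hO : OrderExt f r)
    {lb a C l γ : ℝ} {x : Ed d} {N : ℕ} (hN : N ≤ m) (hNγ : ∀ n : ℕ, n < N → (n : ℝ) ≤ γ)
    (hC : 0 ≤ C) (hl : 0 < l) (hllb : l ≤ lb)
    (hul : l ≤ u) (hxK : closedBall x (lb + 2 * ρ) ⊆ K')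
    (hF : ∀ L : ℝ, 0 < L → L ≤ 2 * (lb + ρ) → ∀ φ ∈ TB d r, |f (scTF φ x L)| ≤ C * L ^ a)
    {φ : Ed d → ℝ} (hφ : φ ∈ TBAnn d r γ) :
    |f (kstar Kf (scTF φ x l))| ≤ cA d r N ρ c a * C * (u ^ β * (l * u⁻¹) ^ N * u ^ a) := by
  have hu := h.hu
  have hu1 := h.hu1
  have hc := h.hc
  have hρ := h.hρ
  have h0 := omegaV_nonneg (d := d)
  have hρu : ρ * u ≤ ρ := by nlinarith
  have hρu0 : 0 < ρ * u := by positivity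
  set L := 2 * (l + ρ * u) with hLdef
  have hL : 0 < L := by positivity
  have hT := scTF_isTest (x := x) hφ.1.1 hφ.1.2.1 hl
  have hsupp := kstar_tsupport h.supp (scTF_supp hφ.1.2.1 hl (x := x))
  have hLq : L ≤ (2 * (1 + ρ)) * u := by rw [hLdef]; linarith
  have hq1 : 1 ≤ 2 * (1 + ρ) := by linarith
  have key := transfer (x := x) (L := L) (B := C * L ^ a)
    (A := ((d:ℝ) ^ N * omegaV d + 1) * (c * u ^ β * (l * u⁻¹) ^ N) * (2 * (1 + ρ)) ^ (d + r)) hO hL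
    (hF L hL (by rw [hLdef]; linarith)) (isCr_kstar h.cmr h.supp hT)
    (hsupp.trans (closedBall_subset_closedBall (by rw [hLdef]; linarith))) (by positivity)
    (fun k hk y => by
      by_cases hy : dist y x ≤ l + ρ * u
      · have hb := kstar_bound_ann h.cmr h.supp hφ (x := x) hl N hN hNγ k hk (y := y)
          (M := c * (u ^ β * u⁻¹ ^ (d + mdeg k + N))) (by positivity) (fun k' hk' z hz => by
            have := h.size k' k (hk'.le.trans hN) hk z (hxK ?_) y (hxK ?_)
            · rwa [hk'] at this
            · rw [mem_closedBall]; linarith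
            · rw [mem_closedBall]; linarith)
        refine hb.trans ?_
        have h1 := inv_pow_scale (d := d) (r := r) hu hL hLq hq1 hk
        calc _ = (d:ℝ) ^ N * omegaV d * (c * u ^ β * (l * u⁻¹) ^ N) * u⁻¹ ^ (d + mdeg k) := by
              rw [pow_add u⁻¹ (d + mdeg k), mul_pow]; ring
          _ ≤ ((d:ℝ) ^ N * omegaV d + 1) * (c * u ^ β * (l * u⁻¹) ^ N) *
              ((2 * (1 + ρ)) ^ (d + r) * ((L ^ d)⁻¹ * L⁻¹ ^ mdeg k)) := by
              gcongr
              linarith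
          _ = _ := by ring
      · have : mderiv k (kstar Kf (scTF φ x l)) y = 0 := by
          by_contra hne
          exact hy (hsupp (mderiv_tsupport k _ (subset_tsupport _ hne)))
        rw [this, abs_zero]
        positivity)
  refine key.trans ?_
  have hLa := rpow_two_sided (p := 2 * ρ) (q := 2 * (1 + ρ)) (t := u) (L := L) (a := a)
    (by positivity) hu (by rw [hLdef]; linarith) hLq
  calc _ ≤ ((d:ℝ) ^ N * omegaV d + 1) * (c * u ^ β * (l * u⁻¹) ^ N) * (2 * (1 + ρ)) ^ (d + r) *
        (C * (((2 * ρ) ^ a + (2 * (1 + ρ)) ^ a) * u ^ a)) := by gcongr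
    _ = _ := by rw [cA]; ring

end piece

lemma RegKer.piece {β ρ : ℝ} {m r : ℕ} {Kn : ℕ → Ed d → Ed d → ℝ} (hρ : 0 < ρ)
    (hK : RegKer d β m r ρ Kn) {K' : Set (Ed d)} (hK' : IsCompact K') :
    ∃ c : ℝ, 0 < c ∧ ∀ n : ℕ, KPiece d m r β ρ c (2 ^ (-(n:ℝ))) K' (Kn n) := by
  obtain ⟨c, hc, h1, h2⟩ := hK.2.2 K' hK'
  have e : ∀ n : ℕ, ((2:ℝ) ^ (-(n:ℝ))) ^ β = 2 ^ (-(β * (n:ℝ))) := fun n => by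
    rw [← Real.rpow_mul two_pos.le]; ring_nf
  refine ⟨c, hc, fun n => ⟨by positivity, ?_, hc, hρ, hK.1 n, hK.2.1 n, ?_, ?_⟩⟩
  · exact Real.rpow_le_one_of_one_le_of_nonpos one_le_two (by simp)
  · intro k l hk hl x hx y hy
    refine (h1 n k l hk hl x hx y hy).trans (le_of_eq ?_)
    rw [e, ← Real.rpow_neg two_pos.le, ← Real.rpow_natCast, ← Real.rpow_mul two_pos.le,
      ← Real.rpow_add two_pos]
    congr 2
    push_cast
    ring
  · intro k l hk hl y hy
    rw [e]
    exact h2 n k l hk hl y hy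

/-! ### Summation over scales -/

lemma half_rpow_lt_one {p : ℝ} (hp : 0 < p) : (2:ℝ) ^ (-p) < 1 :=
  Real.rpow_lt_one_of_one_lt_of_neg one_lt_two (by linarith)

lemma two_scale_sum {a : ℕ → ℝ} {P l p q : ℝ} (hP : 0 ≤ P) (hl : 0 < l) (hp : 0 < p) (hq : 0 < q)
    (ha : Summable a)
    (h1 : ∀ n : ℕ, l * 2 ^ n ≤ 1 → |a n| ≤ P * (l * 2 ^ n) ^ p)
    (h2 : ∀ n : ℕ, 1 < l * 2 ^ n → |a n| ≤ P * (l * 2 ^ n) ^ (-q)) :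
    |∑' n, a n| ≤ P * ((1 - 2 ^ (-p))⁻¹ + (1 - 2 ^ (-q))⁻¹) := by
  have hex : ∃ n : ℕ, 1 < l * 2 ^ n := by
    obtain ⟨n, hn⟩ := pow_unbounded_of_one_lt l⁻¹ (one_lt_two (α := ℝ))
    refine ⟨n, ?_⟩
    rwa [inv_lt_iff_one_lt_mul₀ hl, mul_comm] at hn
  set n0 := Nat.find hex with hn0
  have hspec : 1 < l * 2 ^ n0 := Nat.find_spec hex
  have hθ := half_rpow_lt_one hp
  have hη := half_rpow_lt_one hq
  have hθ0 : (0:ℝ) < 2 ^ (-p) := by positivity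
  have hη0 : (0:ℝ) < 2 ^ (-q) := by positivity
  rw [← ha.sum_add_tsum_nat_add n0, mul_add]
  refine (abs_add_le _ _).trans (add_le_add ?_ ?_)
  · refine (Finset.abs_sum_le_sum_abs _ _).trans ?_
    have h3 : ∀ n ∈ Finset.range n0, |a n| ≤ P * ((2:ℝ) ^ (-p)) ^ (n0 - 1 - n) := by
      intro n hn
      have hn' := Finset.mem_range.1 hn
      have hle : l * 2 ^ n ≤ 1 := not_lt.1 (Nat.find_min hex hn')
      refine (h1 n hle).trans (mul_le_mul_of_nonneg_left ?_ hP)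
      have hle' : l * 2 ^ (n0 - 1) ≤ 1 := not_lt.1 (Nat.find_min hex (by omega))
      have h4 : l * 2 ^ n ≤ (2:ℝ) ^ (-((n0 - 1 - n : ℕ) : ℝ)) := by
        rw [Real.rpow_neg two_pos.le, Real.rpow_natCast, ← one_div,
          le_div_iff₀ (by positivity), mul_assoc, ← pow_add]
        rwa [show n + (n0 - 1 - n) = n0 - 1 by omega]
      refine (Real.rpow_le_rpow (by positivity) h4 hp.le).trans (le_of_eq ?_)
      rw [← Real.rpow_natCast, ← Real.rpow_mul two_pos.le, ← Real.rpow_mul two_pos.le]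
      ring_nf
    refine (Finset.sum_le_sum h3).trans ?_
    rw [← Finset.mul_sum, Finset.sum_range_reflect (fun j => ((2:ℝ) ^ (-p)) ^ j) n0]
    refine mul_le_mul_of_nonneg_left ?_ hP
    rw [← tsum_geometric_of_lt_one hθ0.le hθ]
    exact (summable_geometric_of_lt_one hθ0.le hθ).sum_le_tsum _ fun _ _ => by positivity
  · have hs := (hasSum_geometric_of_lt_one hη0.le hη).mul_left P
    rw [← Real.norm_eq_abs]
    refine tsum_of_norm_bounded hs fun n => ?_
    have h5 : (2:ℝ) ^ n ≤ l * 2 ^ (n + n0) := by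
      rw [pow_add]
      have : (0:ℝ) < 2 ^ n := by positivity
      nlinarith
    rw [Real.norm_eq_abs]
    by_cases hn : n = 0
    · subst hn
      have h6 := h2 (0 + n0) (by simpa using hspec)
      refine h6.trans (mul_le_mul_of_nonneg_left ?_ hP)
      rw [pow_zero, zero_add]
      exact Real.rpow_le_one_of_one_le_of_nonpos hspec.le (by linarith)
    · have h7 : (1:ℝ) < 2 ^ n := one_lt_pow₀ one_lt_two hn
      refine (h2 (n + n0) (by linarith)).trans (mul_le_mul_of_nonneg_left ?_ hP)
      refine (Real.rpow_le_rpow_of_nonpos (by positivity) h5 (by linarith)).trans (le_of_eq ?_)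
      rw [← Real.rpow_natCast, ← Real.rpow_natCast, ← Real.rpow_mul two_pos.le,
        ← Real.rpow_mul two_pos.le]
      ring_nf

lemma rpow_geom (β : ℝ) (n : ℕ) : ((2:ℝ) ^ (-(n:ℝ))) ^ β = ((2:ℝ) ^ (-β)) ^ n := by
  rw [← Real.rpow_natCast, ← Real.rpow_mul two_pos.le, ← Real.rpow_mul two_pos.le]
  ring_nf

lemma test_bound (r : ℕ) {ψ : Ed d → ℝ} (hψ : IsTest ψ) :
    ∃ M : ℝ, 0 ≤ M ∧ ∀ k : MIdx d, mdeg k ≤ r → ∀ z, |mderiv k ψ z| ≤ M := by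
  have h1 : ∀ k : MIdx d, ∃ M : ℝ, 0 ≤ M ∧ (mdeg k ≤ r → ∀ z, |mderiv k ψ z| ≤ M) := by
    intro k
    by_cases hk : mdeg k ≤ r
    · have hcont : Continuous (mderiv k ψ) := ((SCr_of_contDiff r hψ.1).isCr k hk).1
      obtain ⟨M, hM⟩ := (mderiv_hasCompactSupport k hψ.2).exists_bound_of_continuous hcont
      exact ⟨M, (norm_nonneg _).trans (hM 0), fun _ z => hM z⟩
    · exact ⟨0, le_rfl, fun h => absurd h hk⟩
  choose M hM0 hM using h1
  refine ⟨∑ k ∈ (finite_midx (d := d) r).toFinset, M k, Finset.sum_nonneg fun k _ => hM0 k,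
    fun k hk z => (hM k hk z).trans ?_⟩
  exact Finset.single_le_sum (fun k _ => hM0 k) (by simpa using hk)

/-- The series defining `𝖪 f (ψ)` converges absolutely. -/
lemma summable_KInt {β ρ : ℝ} {m r : ℕ} {Kn : ℕ → Ed d → Ed d → ℝ} (hβ : 0 < β) (hρ : 0 < ρ)
    (hK : RegKer d β m r ρ Kn) {f : DFunc d} (hO : OrderExt f r) {ψ : Ed d → ℝ}
    (hψ : IsTest ψ) : Summable fun n => f (kstar (Kn n) ψ) := by
  obtain ⟨R, hR⟩ := hψ.2.isBounded.subset_closedBall (0 : Ed d)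
  obtain ⟨C, hC⟩ := hO.2.2 (closedBall 0 (R + ρ)) (isCompact_closedBall _ _)
  obtain ⟨c, hc, hp⟩ := hK.piece hρ (isCompact_closedBall (0 : Ed d) (R + 2 * ρ))
  obtain ⟨M, hM0, hM⟩ := test_bound r hψ
  have hct := cTwo_pos d r hρ
  have hg := (summable_geometric_of_lt_one (by positivity) (half_rpow_lt_one hβ)).mul_left
    (|C| * (cTwo d r ρ * c * M))
  refine Summable.of_norm_bounded hg fun n => ?_
  have h := hp n
  have hu := h.hu
  have hρu : ρ * 2 ^ (-(n:ℝ)) ≤ ρ := mul_le_of_le_one_right hρ.le h.hu1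
  have hsupp := kstar_tsupport h.supp hR
  have hsupp' := hsupp.trans (closedBall_subset_closedBall (add_le_add_right hρu R))
  have hb := hC _ (isCr_kstar h.cmr h.supp hψ)
    ((isCompact_closedBall _ _).of_isClosed_subset (isClosed_tsupport _) hsupp) hsupp'
  have hcr : crNorm r (kstar (Kn n) ψ) ≤ cTwo d r ρ * c * M * ((2:ℝ) ^ (-β)) ^ n := by
    refine Real.iSup_le (fun k => Real.iSup_le (fun y => ?_) (by positivity)) (by positivity)
    by_cases hy : dist y 0 ≤ R + ρ
    · refine (h.mom_bound hψ k.1 k.2 hM0 ?_ fun j hj z => hM j (hj.trans k.2) z).trans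
        (le_of_eq ?_)
      · exact closedBall_subset_closedBall' (by linarith)
      · rw [rpow_geom]; ring
    · have : mderiv k.1 (kstar (Kn n) ψ) y = 0 := by
        by_contra hne
        exact hy (hsupp' (mderiv_tsupport k.1 _ (subset_tsupport _ hne)))
      rw [this, abs_zero]
      positivity
  have hcr0 : 0 ≤ crNorm r (kstar (Kn n) ψ) :=
    Real.iSup_nonneg fun k => Real.iSup_nonneg fun y => abs_nonneg _
  rw [Real.norm_eq_abs]
  calc _ ≤ C * crNorm r (kstar (Kn n) ψ) := hb
    _ ≤ |C| * crNorm r (kstar (Kn n) ψ) := by gcongr; exact le_abs_self C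
    _ ≤ |C| * (cTwo d r ρ * c * M * ((2:ℝ) ^ (-β)) ^ n) := by gcongr
    _ = _ := by ring

lemma exists_deg (γ : ℝ) (m : ℕ) (hm : γ < m) :
    ∃ N : ℕ, N ≤ m ∧ γ < N ∧ ∀ n : ℕ, n < N → (n:ℝ) ≤ γ := by
  rcases lt_or_ge γ 0 with h | h
  · exact ⟨0, Nat.zero_le _, by simpa using h, fun n hn => absurd hn (Nat.not_lt_zero n)⟩
  · refine ⟨⌊γ⌋₊ + 1, ?_, by exact_mod_cast Nat.lt_floor_add_one γ, fun n hn => ?_⟩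
    · have := (Nat.floor_lt h).2 hm
      omega
    · exact (Nat.le_floor_iff h).1 (by omega)

lemma zero_mem_TB (d r : ℕ) : (0 : Ed d → ℝ) ∈ TB d r := by
  refine ⟨⟨contDiff_const, HasCompactSupport.zero⟩, ?_, fun k _ x => ?_⟩
  · simp [tsupport]
  · by_contra h
    have hne : mderiv k (0 : Ed d → ℝ) x ≠ 0 := fun h0 => h (by simp [h0])
    have := mderiv_tsupport k _ (subset_tsupport _ hne)
    simp [tsupport] at this

theorem main_aux
    (d : ℕ) (β ρ abar : ℝ) (m r : ℕ) (hβ : 0 < β) (hρ : 0 < ρ)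
    (hm : abar + β < (m : ℝ))
    (Kn : ℕ → Ed d → Ed d → ℝ) (hK : RegKer d β m r ρ Kn) :
    ∀ K : Set (Ed d), IsCompact K → ∀ lb : ℝ, 1 ≤ lb → ∃ cst : ℝ,
      ∀ F : GermF d, IsGerm F → (∀ x, OrderExt (F x) r) → Homog F abar r →
        ∃ KF : GermF d,
          (∀ x, KInt Kn (F x) (KF x)) ∧
          ∀ C : ℝ, HomB F abar r K (2 * (lb + ρ)) C →
            WHomB KF (abar + β) r K lb (cst * C) := by
  intro K hKc lb hlb
  obtain ⟨R, hR⟩ := hKc.isBounded.subset_closedBall (0 : Ed d)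
  obtain ⟨c, hc, hp⟩ := hK.piece hρ (isCompact_closedBall (0 : Ed d) (R + (lb + 2 * ρ)))
  obtain ⟨N, hNm, hγN, hNγ⟩ := exists_deg (abar + β) m hm
  set D1 := cA d r N ρ c abar with hD1
  set D2 := cB d r ρ c lb abar with hD2
  have hD1' : 0 ≤ D1 := cA_nonneg hρ hc
  have hD2' : 0 ≤ D2 := cB_nonneg hρ hc hlb
  set p := (N:ℝ) - (abar + β) with hpdef
  have hp0 : 0 < p := by rw [hpdef]; linarith
  set S := (1 - (2:ℝ) ^ (-p))⁻¹ + (1 - (2:ℝ) ^ (-β))⁻¹ with hS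
  have hθ := half_rpow_lt_one hp0
  have hη := half_rpow_lt_one hβ
  have hi1 : 0 ≤ (1 - (2:ℝ) ^ (-p))⁻¹ := inv_nonneg.2 (by linarith)
  have hi2 : 0 ≤ (1 - (2:ℝ) ^ (-β))⁻¹ := inv_nonneg.2 (by linarith)
  have hS0 : 0 ≤ S := add_nonneg hi1 hi2
  refine ⟨(D1 + D2) * S, fun F _ hO _ => ?_⟩
  have hsum : ∀ x ψ, IsTest ψ → Summable fun n => F x (kstar (Kn n) ψ) :=
    fun x ψ hψ => summable_KInt hβ hρ hK (hO x) hψ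
  refine ⟨fun x ψ => ∑' n, F x (kstar (Kn n) ψ), fun x ψ hψ => (hsum x ψ hψ).hasSum,
    fun C hC => ?_⟩
  have hC0 : ∀ x ∈ K, 0 ≤ C := by
    intro x hx
    have := (abs_nonneg _).trans (hC x hx 1 one_pos (by linarith) 0 (zero_mem_TB d r))
    simpa using this
  have hball : ∀ x ∈ K, closedBall x (lb + 2 * ρ) ⊆ closedBall (0 : Ed d) (R + (lb + 2 * ρ)) := by
    intro x hx
    have := hR hx
    rw [mem_closedBall] at this
    exact closedBall_subset_closedBall' (by linarith)
  have hu2 : ∀ n : ℕ, (2:ℝ) ^ (-(n:ℝ)) = ((2:ℝ) ^ n)⁻¹ := fun n => by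
    rw [Real.rpow_neg two_pos.le, Real.rpow_natCast]
  constructor
  · intro x hx l hl hllb φ hφ
    have hCx := hC0 x hx
    have hT := scTF_isTest (x := x) hφ.1.1 hφ.1.2.1 hl
    have hlγ : 0 < l ^ (abar + β) := Real.rpow_pos_of_pos hl _
    have key := two_scale_sum (P := (D1 + D2) * C * l ^ (abar + β)) (p := p) (q := β)
      (l := l) (by positivity) hl hp0 hβ (hsum x _ hT) (fun n hn => ?_) (fun n hn => ?_)
    · refine key.trans (le_of_eq ?_)
      rw [hS]; ring
    · have hu := (hp n).hu
      have hul : l ≤ 2 ^ (-(n:ℝ)) := by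
        rwa [hu2, ← one_div, le_div_iff₀ (by positivity)]
      have h1 := (hp n).large (hO x) hNm hNγ hCx hl hllb hul (hball x hx)
        (fun L h0 hL φ hφ => hC x hx L h0 hL φ hφ) hφ
      refine h1.trans ?_
      have e : (((2:ℝ) ^ (-(n:ℝ))) ^ β * (l * ((2:ℝ) ^ (-(n:ℝ)))⁻¹) ^ N *
          ((2:ℝ) ^ (-(n:ℝ))) ^ abar) = l ^ (abar + β) * (l * 2 ^ n) ^ p := by
        have h2 : (0:ℝ) < 2 ^ n := by positivity
        rw [hu2, inv_inv, ← Real.rpow_natCast (l * 2 ^ n) N, Real.inv_rpow h2.le,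
          Real.inv_rpow h2.le, Real.mul_rpow hl.le h2.le, Real.mul_rpow hl.le h2.le, hpdef,
          Real.rpow_sub hl, Real.rpow_sub h2, Real.rpow_add h2]
        have h3 := Real.rpow_pos_of_pos h2 abar
        have h4 := Real.rpow_pos_of_pos h2 β
        field_simp
      rw [e, mul_assoc ((D1 + D2) * C)]
      have h5 : 0 < (l * 2 ^ n) ^ p := Real.rpow_pos_of_pos (by positivity) _
      gcongr
      linarith
    · have hu := (hp n).hu
      have hul : 2 ^ (-(n:ℝ)) ≤ l := by
        rw [hu2, ← one_div, div_le_iff₀ (by positivity)]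
        exact hn.le
      have h1 := (hp n).small (hO x) hlb hCx hl hllb hul (hball x hx)
        (fun L h0 hL φ hφ => hC x hx L h0 hL φ hφ) hφ.1
      refine h1.trans ?_
      have e : (((2:ℝ) ^ (-(n:ℝ))) ^ β * l ^ abar) =
          l ^ (abar + β) * (l * 2 ^ n) ^ (-β) := by
        have h2 : (0:ℝ) < 2 ^ n := by positivity
        rw [hu2, Real.inv_rpow h2.le, Real.mul_rpow hl.le h2.le, Real.rpow_neg hl.le,
          Real.rpow_neg h2.le, Real.rpow_add hl]
        have h3 := Real.rpow_pos_of_pos hl β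
        have h4 := Real.rpow_pos_of_pos h2 β
        field_simp
      rw [e, mul_assoc ((D1 + D2) * C)]
      have h5 : 0 < (l * 2 ^ n) ^ (-β) := Real.rpow_pos_of_pos (by positivity) _
      gcongr
      linarith
  · intro x hx ψ hψ
    have hCx := hC0 x hx
    have hs := (hasSum_geometric_of_lt_one (by positivity) hη).mul_left (D2 * C)
    have key : ‖∑' n, F x (kstar (Kn n) (scTF ψ x 1))‖ ≤ D2 * C * (1 - (2:ℝ) ^ (-β))⁻¹ := by
      refine tsum_of_norm_bounded hs fun n => ?_
      have h1 := (hp n).small (hO x) hlb hCx one_pos hlb (hp n).hu1 (hball x hx)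
        (fun L h0 hL φ hφ => hC x hx L h0 hL φ hφ) hψ
      rwa [Real.one_rpow, mul_one, rpow_geom] at h1
    rw [Real.norm_eq_abs] at key
    refine key.trans ?_
    rw [hS]
    have h1 : D2 * C * (1 - (2:ℝ) ^ (-β))⁻¹ ≤ (D1 + D2) * C * S := by
      gcongr
      · linarith
      · rw [hS]; linarith
    refine h1.trans (le_of_eq ?_)
    rw [hS]; ring

/-- Theorem 4.3, integration of germs — homogeneity: if `𝖪` is a
`β`-regularising kernel of order `(m,r)` with range `ρ` and `m > ᾱ + β`, then for every
compact `K` and `λ̄ ∈ [1,∞)` there is a constant `cst'` such that for every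
`ᾱ`-homogeneous germ `F` of order `r`, the germ `𝖪F` is well-defined and weakly
`(ᾱ+β)`-homogeneous of order `r`, with
`‖𝖪F‖_{weak-hom;K,λ̄,r} ≤ cst' ‖F‖_{hom;K,2(λ̄+ρ),r}`. -/
theorem integration_of_germs_homogeneity
    (d : ℕ) (β ρ abar : ℝ) (m r : ℕ) (hβ : 0 < β) (hρ : 0 < ρ)
    (hm : abar + β < (m : ℝ))
    (Kn : ℕ → Ed d → Ed d → ℝ) (hK : RegKer d β m r ρ Kn) :
    ∀ K : Set (Ed d), IsCompact K → ∀ lb : ℝ, 1 ≤ lb → ∃ cst : ℝ,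
      ∀ F : GermF d, IsGerm F → (∀ x, OrderExt (F x) r) → Homog F abar r →
        ∃ KF : GermF d,
          (∀ x, KInt Kn (F x) (KF x)) ∧
          ∀ C : ℝ, HomB F abar r K (2 * (lb + ρ)) C →
            WHomB KF (abar + β) r K lb (cst * C) := by
  exact main_aux d β ρ abar m r hβ hρ hm Kn hK
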